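/- arXiv:2011.11903 — 2 statements merged into one kernel-verified Lean document; each statement's English description precedes it below -/
import Mathlib

section
/- For bond percolation on the two-dimensional torus T²_N: if p < 1/2 then ℙ_p(A^□) → 0 as N → ∞, and if p > 1/2 then ℙ_p(S^□) → 1 as N → ∞. -/
/-!
Bond percolation on the torus `T^d_N`.  A configuration assigns `true`/`false`
(open/closed) to each edge of the graph on `(ℤ/Nℤ)^d` in which a vertex is joined
to its translates by standard basis vectors; edges are indexed by a vertex together
with a direction.  A configuration lifts `N`-periodically to `ℤ^d`, and the
giant-cycle event `A^□` asks for two distinct points of `ℤ^d`, congruent mod `N`,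
joined by a path of open edges of the periodic lift.
-/

namespace TorusPerc

/-- The standard basis vector `e i` of `ℤ^d`. -/
def stdVec (d : ℕ) (i : Fin d) : Fin d → ℤ := fun j => if j = i then 1 else 0

/-- An edge of the cubical torus: a vertex of `(ℤ/Nℤ)^d` together with a direction. -/
abbrev Edge (d N : ℕ) := (Fin d → ZMod N) × Fin d

/-- A bond configuration on the torus. -/
abbrev Config (d N : ℕ) := Edge d N → Bool

/-- Reduction of a point of `ℤ^d` modulo `N`. -/
def proj (d N : ℕ) (x : Fin d → ℤ) : Fin d → ZMod N := fun i => (x i : ZMod N)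

/-- The edge of the periodic lift going from `x` in direction `i` is open. -/
def liftOpen (d N : ℕ) (ω : Config d N) (x : Fin d → ℤ) (i : Fin d) : Prop :=
  ω (proj d N x, i) = true

/-- One step along an open edge of the periodic lift. -/
def step (d N : ℕ) (ω : Config d N) (x y : Fin d → ℤ) : Prop :=
  (∃ i, y = x + stdVec d i ∧ liftOpen d N ω x i) ∨
  (∃ i, x = y + stdVec d i ∧ liftOpen d N ω y i)

/-- Connectivity by paths of open edges in the periodic lift. -/
def connected (d N : ℕ) (ω : Config d N) : (Fin d → ℤ) → (Fin d → ℤ) → Prop :=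
  Relation.ReflTransGen (step d N ω)

/-- The giant-cycle event `A^□`: some two distinct points of `ℤ^d` which are congruent
modulo `N` are joined by an open path of the periodic lift. -/
def giantEvent (d N : ℕ) : Set (Config d N) :=
  {ω | ∃ x y : Fin d → ℤ, x ≠ y ∧ proj d N x = proj d N y ∧ connected d N ω x y}

/-- The set of winding vectors realized by a configuration. -/
def winding (d N : ℕ) (ω : Config d N) : Set (Fin d → ℤ) :=
  {w | ∃ x : Fin d → ℤ, connected d N ω x (x + (N : ℤ) • w)}

/-- The realized winding vectors, regarded as vectors in `ℚ^d`. -/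
def windingQ (d N : ℕ) (ω : Config d N) : Set (Fin d → ℚ) :=
  (fun w : Fin d → ℤ => fun i => (w i : ℚ)) '' winding d N ω

/-- The spanning event `S^□`: the realized winding vectors span `ℚ^d`. -/
def spanEvent (d N : ℕ) : Set (Config d N) :=
  {ω | Submodule.span ℚ (windingQ d N ω) = ⊤}

/-- The probability of an event under Bernoulli(`p`) bond percolation on the torus:
each edge is open independently with probability `p`. -/
noncomputable def prob (d N : ℕ) (p : ℝ) (S : Set (Config d N)) : ℝ :=
  ∑ᶠ ω ∈ S, ∏ᶠ e : Edge d N, (if ω e then p else 1 - p)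

end TorusPerc



namespace HK

section Analysis

set_option linter.unusedSectionVars false

variable {ι : Type*} [Fintype ι] [DecidableEq ι]

/-- Bernoulli weight of a bit. -/
noncomputable def wt (p : ℝ) (b : Bool) : ℝ := if b then p else 1 - p

/-- Product Bernoulli weight. -/
noncomputable def mu (p : ℝ) (x : ι → Bool) : ℝ := ∏ i, wt p (x i)

/-- Expectation. -/
noncomputable def Ex (p : ℝ) (f : (ι → Bool) → ℝ) : ℝ := ∑ x, mu p x * f x

lemma wt_nonneg {p : ℝ} (h0 : 0 ≤ p) (h1 : p ≤ 1) (b : Bool) : 0 ≤ wt p b := by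
  unfold wt; split_ifs <;> linarith

lemma mu_nonneg {p : ℝ} (h0 : 0 ≤ p) (h1 : p ≤ 1) (x : ι → Bool) : 0 ≤ mu p x :=
  Finset.prod_nonneg fun _ _ => wt_nonneg h0 h1 _

lemma Ex_mono {p : ℝ} (h0 : 0 ≤ p) (h1 : p ≤ 1) {f g : (ι → Bool) → ℝ} (h : ∀ x, f x ≤ g x) :
    Ex p f ≤ Ex p g :=
  Finset.sum_le_sum fun x _ => mul_le_mul_of_nonneg_left (h x) (mu_nonneg h0 h1 x)

lemma Ex_nonneg {p : ℝ} (h0 : 0 ≤ p) (h1 : p ≤ 1) {f : (ι → Bool) → ℝ} (h : ∀ x, 0 ≤ f x) :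
    0 ≤ Ex p f :=
  Finset.sum_nonneg fun x _ => mul_nonneg (mu_nonneg h0 h1 x) (h x)

lemma Ex_add (p : ℝ) (f g : (ι → Bool) → ℝ) :
    Ex p (fun x => f x + g x) = Ex p f + Ex p g := by
  simp [Ex, mul_add, Finset.sum_add_distrib]

lemma Ex_mul_left (p c : ℝ) (f : (ι → Bool) → ℝ) :
    Ex p (fun x => c * f x) = c * Ex p f := by
  simp only [Ex, Finset.mul_sum]; exact Finset.sum_congr rfl fun x _ => by ring

lemma Ex_sum {κ : Type*} (p : ℝ) (s : Finset κ) (f : κ → (ι → Bool) → ℝ) :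
    Ex p (fun x => ∑ k ∈ s, f k x) = ∑ k ∈ s, Ex p (f k) := by
  simp only [Ex, Finset.mul_sum]; exact Finset.sum_comm

lemma sum_mu (p : ℝ) : ∑ x : ι → Bool, mu p x = 1 := by
  have h := (Finset.prod_univ_sum (fun _ : ι => (Finset.univ : Finset Bool))
    (fun _ b => wt p b)).symm
  rw [Fintype.piFinset_univ] at h
  simp only [mu]
  rw [h]
  simp [wt]

lemma Ex_one (p : ℝ) : Ex p (fun _ : ι → Bool => (1 : ℝ)) = 1 := by
  simp [Ex, sum_mu]

lemma Ex_cs {p : ℝ} (h0 : 0 ≤ p) (h1 : p ≤ 1) (u v : (ι → Bool) → ℝ) :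
    (Ex p (fun x => u x * v x)) ^ 2 ≤ Ex p (fun x => u x ^ 2) * Ex p (fun x => v x ^ 2) := by
  unfold Ex
  apply Finset.sum_sq_le_sum_mul_sum_of_sq_le_mul
  · intro x _; exact mul_nonneg (mu_nonneg h0 h1 x) (sq_nonneg _)
  · intro x _; exact mul_nonneg (mu_nonneg h0 h1 x) (sq_nonneg _)
  · intro x _; apply le_of_eq; ring

/-- Pairing principle. -/
lemma sum_pair (i : ι) (F G : (ι → Bool) → ℝ)
    (h : ∀ x, F (Function.update x i true) + F (Function.update x i false)
      = G (Function.update x i true) + G (Function.update x i false)) :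
    ∑ x, F x = ∑ x, G x := by
  let fl : (ι → Bool) → (ι → Bool) := fun x => Function.update x i (!x i)
  have hfl : Function.Involutive fl := by
    intro x
    simp [fl]
  have key : ∀ F : (ι → Bool) → ℝ, ∑ x, F x = ∑ x, F (fl x) := fun F =>
    (Equiv.sum_comp hfl.toPerm F).symm
  have h2 : ∑ x, (F x + F (fl x)) = ∑ x, (G x + G (fl x)) := by
    refine Finset.sum_congr rfl fun x _ => ?_
    have hx := h x
    cases hb : x i
    · have e1 : Function.update x i false = x := by rw [← hb]; simp
      have e2 : fl x = Function.update x i true := by simp [fl, hb]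
      rw [e1] at hx
      rw [e2]; linarith
    · have e1 : Function.update x i true = x := by rw [← hb]; simp
      have e2 : fl x = Function.update x i false := by simp [fl, hb]
      rw [e1] at hx
      rw [e2]; linarith
  rw [Finset.sum_add_distrib, Finset.sum_add_distrib, ← key F, ← key G] at h2
  linarith

lemma prod_erase_update (p : ℝ) (i : ι) (x : ι → Bool) (b : Bool) :
    ∏ j ∈ Finset.univ.erase i, wt p (Function.update x i b j)
      = ∏ j ∈ Finset.univ.erase i, wt p (x j) := by
  refine Finset.prod_congr rfl fun j hj => ?_
  rw [Function.update_of_ne (Finset.ne_of_mem_erase hj)]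

lemma mu_update (p : ℝ) (i : ι) (x : ι → Bool) (b : Bool) :
    mu p (Function.update x i b) = wt p b * ∏ j ∈ Finset.univ.erase i, wt p (x j) := by
  unfold mu
  rw [← Finset.mul_prod_erase Finset.univ _ (Finset.mem_univ i), prod_erase_update]
  simp

lemma Ex_resample (p : ℝ) (i : ι) (G : (ι → Bool) → ℝ) :
    Ex p G = Ex p (fun x => p * G (Function.update x i true)
      + (1 - p) * G (Function.update x i false)) := by
  unfold Ex
  apply sum_pair i
  intro x
  simp only [mu_update, Function.update_idem, wt]
  simp
  ring

/-- discrete derivative -/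
def piv (f : (ι → Bool) → ℝ) (i : ι) (x : ι → Bool) : ℝ :=
  f (Function.update x i true) - f (Function.update x i false)

lemma russo (f : (ι → Bool) → ℝ) (p : ℝ) :
    HasDerivAt (fun p => Ex p f) (∑ i, Ex p (piv f i)) p := by
  have hw : ∀ b : Bool, HasDerivAt (fun p => wt p b) (if b then 1 else -1) p := by
    intro b
    cases b
    · simpa [wt] using (hasDerivAt_id p).const_sub 1
    · simpa [wt] using hasDerivAt_id' p
  have h1 : HasDerivAt (fun p => Ex p f)
      (∑ x : ι → Bool, (∑ i, (∏ j ∈ Finset.univ.erase i, wt p (x j)) •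
        (if x i then (1 : ℝ) else -1)) * f x) p := by
    unfold Ex
    apply HasDerivAt.fun_sum
    intro x _
    apply HasDerivAt.mul_const
    unfold mu
    exact HasDerivAt.fun_finsetProd (fun i _ => hw (x i))
  convert h1 using 1
  simp only [Finset.sum_mul]
  rw [Finset.sum_comm]
  refine Finset.sum_congr rfl fun i _ => ?_
  unfold Ex
  apply sum_pair i
  intro x
  simp only [mu_update, prod_erase_update, piv, Function.update_idem, Function.update_self]
  generalize ∏ j ∈ Finset.univ.erase i, wt p (x j) = m
  simp only [wt, if_true, Bool.false_eq_true, if_false, smul_eq_mul]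
  ring

/-- the p-biased character -/
noncomputable def chi (p : ℝ) (b : Bool) : ℝ :=
  if b then √(p * (1 - p)) / p else - (√(p * (1 - p)) / (1 - p))

noncomputable def chiS (p : ℝ) (S : Finset ι) (x : ι → Bool) : ℝ := ∏ i ∈ S, chi p (x i)

noncomputable def coef (p : ℝ) (f : (ι → Bool) → ℝ) (S : Finset ι) : ℝ :=
  Ex p (fun x => f x * chiS p S x)

lemma wt_chi {p : ℝ} (h0 : 0 < p) (h1 : p < 1) (a b : Bool) :
    wt p b * (1 + chi p a * chi p b) = if a = b then 1 else 0 := by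
  have h1' : 0 < 1 - p := by linarith
  have hs : √(p * (1 - p)) ^ 2 = p * (1 - p) := Real.sq_sqrt (by positivity)
  cases a <;> cases b <;>
    simp only [wt, chi, if_true, Bool.false_eq_true, if_false, reduceCtorEq] <;> field_simp <;>
    rw [hs] <;> ring

lemma complete {p : ℝ} (h0 : 0 < p) (h1 : p < 1) (x y : ι → Bool) :
    mu p y * ∑ S : Finset ι, chiS p S x * chiS p S y = if x = y then 1 else 0 := by
  have : ∑ S : Finset ι, chiS p S x * chiS p S y = ∏ i, (1 + chi p (x i) * chi p (y i)) := by
    rw [Finset.prod_one_add, Finset.powerset_univ]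
    simp only [chiS, Finset.prod_mul_distrib]
  rw [this, mu, ← Finset.prod_mul_distrib]
  simp only [wt_chi h0 h1]
  split_ifs with h
  · subst h; simp
  · obtain ⟨i, hi⟩ := Function.ne_iff.mp h
    exact Finset.prod_eq_zero (Finset.mem_univ i) (by simp [hi])

lemma parseval {p : ℝ} (h0 : 0 < p) (h1 : p < 1) (f : (ι → Bool) → ℝ) :
    ∑ S, coef p f S ^ 2 = Ex p (fun x => f x ^ 2) := by
  have : ∀ S, coef p f S ^ 2 = ∑ x, ∑ y, mu p x * f x * f y *
      (mu p y * (chiS p S x * chiS p S y)) := by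
    intro S
    rw [sq, coef, Ex, Finset.sum_mul_sum]
    refine Finset.sum_congr rfl fun x _ => Finset.sum_congr rfl fun y _ => by ring
  simp only [this]
  rw [Finset.sum_comm]
  unfold Ex
  refine Finset.sum_congr rfl fun x _ => ?_
  rw [Finset.sum_comm]
  simp only [← Finset.mul_sum, complete h0 h1]
  simp
  ring

lemma chiS_update (p : ℝ) (S : Finset ι) (i : ι) (hi : i ∉ S) (x : ι → Bool) (b : Bool) :
    chiS p S (Function.update x i b) = chiS p S x := by
  refine Finset.prod_congr rfl fun j hj => ?_
  rw [Function.update_of_ne]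
  rintro rfl; exact hi hj

lemma two_point {p ρ : ℝ} (h0 : 0 < p) (h1 : p < 1) (hρ : 4 * ρ ^ 2 ≤ 1)
    (hρ' : 3 * ρ ^ 4 ≤ p * (1 - p)) (A B : ℝ) :
    p * (A + ρ * chi p true * B) ^ 4 + (1 - p) * (A + ρ * chi p false * B) ^ 4
      ≤ A ^ 4 + 2 * (A ^ 2 * B ^ 2) + B ^ 4 := by
  have h1' : 0 < 1 - p := by linarith
  have hs : √(p * (1 - p)) ^ 2 = p * (1 - p) := Real.sq_sqrt (by positivity)
  have m1 : p * chi p true + (1 - p) * chi p false = 0 := by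
    simp [chi]; field_simp; ring
  have m2 : p * chi p true ^ 2 + (1 - p) * chi p false ^ 2 = 1 := by
    simp [chi]; field_simp; rw [hs]; ring
  have c1 : chi p true ^ 2 * (p * (1 - p)) ≤ 1 := by
    simp only [chi, if_true, div_pow, hs]; field_simp; nlinarith
  have c0 : chi p false ^ 2 * (p * (1 - p)) ≤ 1 := by
    simp [chi, div_pow, hs]; field_simp; nlinarith
  set c := chi p true
  set d := chi p false
  have key : ∀ c : ℝ, c ^ 2 * (p * (1 - p)) ≤ 1 → (A + ρ * c * B) ^ 4 ≤
      A ^ 4 + 4 * A ^ 3 * ρ * B * c + 2 * (A ^ 2 * B ^ 2) * c ^ 2 + B ^ 4 * c ^ 2 := by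
    intro c hc
    have e1 : 0 ≤ (ρ * c * A * B - ρ ^ 2 * c ^ 2 * B ^ 2) ^ 2 := sq_nonneg _
    have e2 : (4 * ρ ^ 2) * (c ^ 2 * (A ^ 2 * B ^ 2)) ≤ 1 * (c ^ 2 * (A ^ 2 * B ^ 2)) :=
      mul_le_mul_of_nonneg_right hρ (by positivity)
    have e3 : (3 * ρ ^ 4) * (c ^ 4 * B ^ 4) ≤ (p * (1 - p)) * (c ^ 4 * B ^ 4) :=
      mul_le_mul_of_nonneg_right hρ' (by positivity)
    have e4 : (c ^ 2 * (p * (1 - p))) * (c ^ 2 * B ^ 4) ≤ 1 * (c ^ 2 * B ^ 4) :=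
      mul_le_mul_of_nonneg_right hc (by positivity)
    nlinarith
  have k1 := mul_le_mul_of_nonneg_left (key c c1) h0.le
  have k2 := mul_le_mul_of_nonneg_left (key d c0) h1'.le
  have e : p * (A ^ 4 + 4 * A ^ 3 * ρ * B * c + 2 * (A ^ 2 * B ^ 2) * c ^ 2 + B ^ 4 * c ^ 2)
    + (1 - p) * (A ^ 4 + 4 * A ^ 3 * ρ * B * d + 2 * (A ^ 2 * B ^ 2) * d ^ 2 + B ^ 4 * d ^ 2)
    = A ^ 4 + 4 * A ^ 3 * ρ * B * (p * c + (1 - p) * d)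
      + (2 * (A ^ 2 * B ^ 2) + B ^ 4) * (p * c ^ 2 + (1 - p) * d ^ 2) := by ring
  rw [m1, m2] at e
  linarith

/-- hypercontractivity -/
lemma hyper {p ρ : ℝ} (h0 : 0 < p) (h1 : p < 1) (hρ : 4 * ρ ^ 2 ≤ 1)
    (hρ' : 3 * ρ ^ 4 ≤ p * (1 - p)) (s : Finset ι) :
    ∀ a : Finset ι → ℝ,
    Ex p (fun x => (∑ S ∈ s.powerset, ρ ^ S.card * a S * chiS p S x) ^ 4)
      ≤ (∑ S ∈ s.powerset, a S ^ 2) ^ 2 := by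
  induction s using Finset.induction_on with
  | empty =>
    intro a
    simp [chiS, Ex, ← Finset.sum_mul, sum_mu]
    apply le_of_eq; ring
  | insert i s hi ih =>
    intro a
    have hA := ih a
    have hB := ih (fun S => a (insert i S))
    set α := ∑ S ∈ s.powerset, a S ^ 2 with hα
    set β := ∑ S ∈ s.powerset, a (insert i S) ^ 2 with hβ
    set A : (ι → Bool) → ℝ := fun x => ∑ S ∈ s.powerset, ρ ^ S.card * a S * chiS p S x with hAd
    set B : (ι → Bool) → ℝ := fun x =>
      ∑ S ∈ s.powerset, ρ ^ S.card * a (insert i S) * chiS p S x with hBd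
    have hα0 : 0 ≤ α := Finset.sum_nonneg fun _ _ => sq_nonneg _
    have hβ0 : 0 ≤ β := Finset.sum_nonneg fun _ _ => sq_nonneg _
    have hns : ∀ S ∈ s.powerset, i ∉ S := fun S hS h => hi (Finset.mem_powerset.mp hS h)
    have hAu : ∀ x b, A (Function.update x i b) = A x := by
      intro x b
      refine Finset.sum_congr rfl fun S hS => ?_
      rw [chiS_update p S i (hns S hS)]
    have hBu : ∀ x b, B (Function.update x i b) = B x := by
      intro x b
      refine Finset.sum_congr rfl fun S hS => ?_
      rw [chiS_update p S i (hns S hS)]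
    have hsplit : ∀ x, ∑ S ∈ (insert i s).powerset, ρ ^ S.card * a S * chiS p S x
        = A x + ρ * chi p (x i) * B x := by
      intro x
      rw [Finset.sum_powerset_insert hi]
      congr 1
      rw [hBd, Finset.mul_sum]
      refine Finset.sum_congr rfl fun S hS => ?_
      rw [Finset.card_insert_of_notMem (hns S hS), chiS, chiS, Finset.prod_insert (hns S hS)]
      ring
    simp only [hsplit]
    rw [Finset.sum_powerset_insert hi, Ex_resample p i]
    simp only [hAu, hBu, Function.update_self]
    have h1' : Ex p (fun x => p * (A x + ρ * chi p true * B x) ^ 4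
        + (1 - p) * (A x + ρ * chi p false * B x) ^ 4)
        ≤ Ex p (fun x => A x ^ 4 + 2 * (A x ^ 2 * B x ^ 2) + B x ^ 4) :=
      Ex_mono h0.le h1.le fun x => two_point h0 h1 hρ hρ' _ _
    have h2' : Ex p (fun x => A x ^ 4 + 2 * (A x ^ 2 * B x ^ 2) + B x ^ 4)
        = Ex p (fun x => A x ^ 4) + 2 * Ex p (fun x => A x ^ 2 * B x ^ 2)
          + Ex p (fun x => B x ^ 4) := by
      rw [Ex_add, Ex_add, Ex_mul_left]
    have hcs := Ex_cs h0.le h1.le (fun x => A x ^ 2) (fun x => B x ^ 2)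
    simp only [← pow_mul] at hcs
    norm_num at hcs
    have hB4 : 0 ≤ Ex p (fun x => B x ^ 4) := Ex_nonneg h0.le h1.le fun x => by positivity
    have : Ex p (fun x => A x ^ 2 * B x ^ 2) ^ 2 ≤ (α * β) ^ 2 := by
      calc _ ≤ _ := hcs
        _ ≤ α ^ 2 * β ^ 2 := mul_le_mul hA hB hB4 (by positivity)
        _ = _ := by ring
    have h3 := abs_le_of_sq_le_sq' this (by positivity)
    have h4 := h3.2
    change Ex p (fun x => A x ^ 4) ≤ α ^ 2 at hA
    change Ex p (fun x => B x ^ 4) ≤ β ^ 2 at hB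
    calc _ ≤ _ := h1'
      _ = _ := h2'
      _ ≤ α ^ 2 + 2 * (α * β) + β ^ 2 := by linarith
      _ = _ := by rw [← hα, ← hβ]; ring

/-- Key estimate for a single coordinate. -/
lemma single {p ρ : ℝ} (h0 : 0 < p) (h1 : p < 1) (hρ0 : 0 ≤ ρ) (hρ : 4 * ρ ^ 2 ≤ 1)
    (hρ' : 3 * ρ ^ 4 ≤ p * (1 - p)) (f : (ι → Bool) → ℝ) (i : ι)
    (hf : ∀ x, piv f i x = 0 ∨ piv f i x = 1) (M : ℝ) (hM : 0 ≤ M)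
    (hI : Ex p (piv f i) ≤ M ^ 2) :
    (∑ S ∈ Finset.univ.filter (fun S : Finset ι => i ∈ S),
      ρ ^ (2 * (S.card - 1)) * coef p f S ^ 2 ≤ Ex p (piv f i) * M) ∧
    (∑ S ∈ Finset.univ.filter (fun S : Finset ι => i ∈ S), coef p f S ^ 2
      ≤ Ex p (piv f i)) := by
  have h1' : 0 < 1 - p := by linarith
  set σ := √(p * (1 - p)) with hσ
  have hs : σ ^ 2 = p * (1 - p) := Real.sq_sqrt (by positivity)
  have hs1 : σ ^ 2 ≤ 1 := by rw [hs]; nlinarith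
  set g := piv f i with hg
  set I := Ex p g with hIdef
  have hg01 : ∀ x, 0 ≤ g x := fun x => by rcases hf x with h | h <;> rw [h] <;> norm_num
  have hg2 : ∀ x, g x ^ 2 = g x := fun x => by rcases hf x with h | h <;> rw [h] <;> norm_num
  have hI0 : 0 ≤ I := Ex_nonneg h0.le h1.le hg01
  -- coefficients
  have hcoef : ∀ T : Finset ι, i ∉ T → coef p f (insert i T) = σ * Ex p (fun x => g x * chiS p T x) := by
    intro T hT
    rw [coef, Ex_resample p i, ← Ex_mul_left]
    congr 1
    funext x
    simp only [chiS, Finset.prod_insert hT, Function.update_self]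
    have := fun b => chiS_update p T i hT x b
    simp only [chiS] at this
    simp only [this, hg, piv]
    generalize ∏ j ∈ T, chi p (x j) = m
    simp only [chi, if_true, Bool.false_eq_true, if_false]
    rw [← hσ]
    field_simp
    ring
  have hbij : ∀ F : Finset ι → ℝ, ∑ S ∈ Finset.univ.filter (fun S : Finset ι => i ∈ S), F S
      = ∑ T ∈ Finset.univ.filter (fun S : Finset ι => i ∉ S), F (insert i T) := by
    intro F
    refine Finset.sum_nbij' (fun S => S.erase i) (fun T => insert i T) ?_ ?_ ?_ ?_ ?_
    · intro S hS; simp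
    · intro T hT; simp
    · intro S hS; simp at hS; simp [hS]
    · intro T hT; simp at hT; simp [hT]
    · intro S hS; simp at hS; simp [hS]
  constructor
  · rw [hbij]
    have e : ∀ T ∈ Finset.univ.filter (fun S : Finset ι => i ∉ S),
        ρ ^ (2 * ((insert i T).card - 1)) * coef p f (insert i T) ^ 2
        = (ρ ^ T.card * coef p f (insert i T)) ^ 2 := by
      intro T hT
      rw [Finset.card_insert_of_notMem (Finset.mem_filter.mp hT).2, Nat.add_sub_cancel]
      ring
    rw [Finset.sum_congr rfl e, Finset.sum_filter]
    set a : Finset ι → ℝ := fun T => if i ∉ T then ρ ^ T.card * coef p f (insert i T) else 0 with ha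
    have e2 : ∑ T : Finset ι, (if i ∉ T then (ρ ^ T.card * coef p f (insert i T)) ^ 2 else 0)
        = ∑ T, a T ^ 2 := by
      refine Finset.sum_congr rfl fun T _ => ?_
      simp only [ha]; split_ifs <;> simp
    rw [e2]
    set q := ∑ T, a T ^ 2 with hq
    have hq0 : 0 ≤ q := Finset.sum_nonneg fun _ _ => sq_nonneg _
    have hyp := hyper h0 h1 hρ hρ' (Finset.univ : Finset ι) a
    rw [Finset.powerset_univ, ← hq] at hyp
    set h : (ι → Bool) → ℝ := fun x => ∑ S : Finset ι, ρ ^ S.card * a S * chiS p S x with hh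
    have hgh : σ * Ex p (fun x => g x * h x) = q := by
      have : (fun x => g x * h x) = fun x => ∑ S : Finset ι, ρ ^ S.card * a S * (g x * chiS p S x) := by
        funext x
        rw [hh, Finset.mul_sum]
        exact Finset.sum_congr rfl fun S _ => by ring
      rw [this, Ex_sum, Finset.mul_sum]
      refine Finset.sum_congr rfl fun T _ => ?_
      rw [Ex_mul_left]
      by_cases hT : i ∈ T
      · simp [ha, hT]
      · have := hcoef T hT
        simp only [ha, hT, not_false_eq_true, if_true]
        rw [this]; ring
    have cs1 := Ex_cs h0.le h1.le g (fun x => g x * h x)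
    have cs2 := Ex_cs h0.le h1.le g (fun x => h x ^ 2)
    have r1 : (fun x => g x * (g x * h x)) = fun x => g x * h x := by
      funext x; rw [← mul_assoc, ← sq, hg2]
    have r2 : (fun x => (g x * h x) ^ 2) = fun x => g x * h x ^ 2 := by
      funext x; rw [mul_pow, hg2]
    have r3 : (fun x => g x ^ 2) = g := funext hg2
    have r4 : (fun x => (h x ^ 2) ^ 2) = fun x => h x ^ 4 := by funext x; ring
    rw [r1, r2, r3] at cs1
    rw [r3, r4] at cs2
    set u := Ex p (fun x => g x * h x)
    set v := Ex p (fun x => g x * h x ^ 2)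
    have hv0 : 0 ≤ v := Ex_nonneg h0.le h1.le fun x => mul_nonneg (hg01 x) (sq_nonneg _)
    have c1 : v ^ 2 ≤ I * q ^ 2 := cs2.trans (mul_le_mul_of_nonneg_left hyp hI0)
    have c1' : v ≤ M * q := by
      have : v ^ 2 ≤ (M * q) ^ 2 := by
        rw [mul_pow]; exact c1.trans (mul_le_mul_of_nonneg_right hI (sq_nonneg _))
      exact (abs_le_of_sq_le_sq' this (by positivity)).2
    have c2 : q ^ 2 ≤ I * M * q := by
      rw [← hgh, mul_pow, hgh]
      calc σ ^ 2 * u ^ 2 ≤ 1 * u ^ 2 := mul_le_mul_of_nonneg_right hs1 (sq_nonneg _)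
        _ = u ^ 2 := one_mul _
        _ ≤ I * v := cs1
        _ ≤ I * (M * q) := mul_le_mul_of_nonneg_left c1' hI0
        _ = _ := by ring
    rcases hq0.eq_or_lt with h | h
    · rw [← h]; positivity
    · nlinarith
  · rw [hbij]
    have e : ∀ T ∈ Finset.univ.filter (fun S : Finset ι => i ∉ S),
        coef p f (insert i T) ^ 2 ≤ coef p g T ^ 2 := by
      intro T hT
      rw [hcoef T (Finset.mem_filter.mp hT).2, mul_pow]
      calc _ ≤ 1 * _ := mul_le_mul_of_nonneg_right hs1 (sq_nonneg _)
        _ = _ := by rw [one_mul, coef]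
    calc _ ≤ _ := Finset.sum_le_sum e
      _ ≤ ∑ T, coef p g T ^ 2 := Finset.sum_le_sum_of_subset_of_nonneg (Finset.filter_subset _ _)
          (fun _ _ _ => sq_nonneg _)
      _ = Ex p (fun x => g x ^ 2) := parseval h0 h1 g
      _ = I := by rw [show (fun x => g x ^ 2) = g from funext hg2]

lemma kkl {p ρ : ℝ} (h0 : 0 < p) (h1 : p < 1) (hρ0 : 0 < ρ) (hρ : 4 * ρ ^ 2 ≤ 1)
    (hρ' : 3 * ρ ^ 4 ≤ p * (1 - p)) (f : (ι → Bool) → ℝ)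
    (hf01 : ∀ x, f x ^ 2 = f x)
    (hf : ∀ i x, piv f i x = 0 ∨ piv f i x = 1) (M : ℝ) (hM : 0 ≤ M)
    (hI : ∀ i, Ex p (piv f i) ≤ M ^ 2) (m : ℕ) (hm : 1 ≤ m) :
    Ex p f * (1 - Ex p f) ≤
      (∑ i, Ex p (piv f i)) / m + (ρ ^ (2 * m))⁻¹ * (M * ∑ i, Ex p (piv f i)) := by
  have hpars := parseval h0 h1 f
  have hm0 : (0 : ℝ) < m := by exact_mod_cast hm
  have hρ1 : ρ ≤ 1 := by nlinarith
  rw [show (fun x => f x ^ 2) = f from funext hf01] at hpars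
  have hempty : coef p f ∅ = Ex p f := by simp [coef, chiS]
  have hsw : ∀ F : Finset ι → ℝ, ∑ i, ∑ S ∈ Finset.univ.filter (fun S : Finset ι => i ∈ S), F S
      = ∑ S : Finset ι, (S.card : ℝ) * F S := by
    intro F
    simp only [Finset.sum_filter]
    rw [Finset.sum_comm]
    refine Finset.sum_congr rfl fun S _ => ?_
    simp
  have s1 : ∑ S : Finset ι, (S.card : ℝ) * coef p f S ^ 2 ≤ ∑ i, Ex p (piv f i) := by
    rw [← hsw]
    exact Finset.sum_le_sum fun i _ => (single h0 h1 hρ0.le hρ hρ' f i (hf i) M hM (hI i)).2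
  have s2 : ∑ S : Finset ι, (S.card : ℝ) * (ρ ^ (2 * (S.card - 1)) * coef p f S ^ 2)
      ≤ M * ∑ i, Ex p (piv f i) := by
    rw [← hsw, Finset.mul_sum]
    refine Finset.sum_le_sum fun i _ => ?_
    rw [mul_comm M]
    exact (single h0 h1 hρ0.le hρ hρ' f i (hf i) M hM (hI i)).1
  have hvar : Ex p f * (1 - Ex p f) = ∑ S ∈ Finset.univ.erase (∅ : Finset ι), coef p f S ^ 2 := by
    rw [← Finset.add_sum_erase _ _ (Finset.mem_univ (∅ : Finset ι)), hempty] at hpars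
    linarith
  rw [hvar]
  have hpt : ∀ S ∈ Finset.univ.erase (∅ : Finset ι), coef p f S ^ 2 ≤
      ((S.card : ℝ) * coef p f S ^ 2) / m +
      (ρ ^ (2 * m))⁻¹ * ((S.card : ℝ) * (ρ ^ (2 * (S.card - 1)) * coef p f S ^ 2)) := by
    intro S hS
    have hc : 1 ≤ S.card := Finset.card_pos.mpr
      (Finset.nonempty_iff_ne_empty.mpr (Finset.ne_of_mem_erase hS))
    have hc' : (1 : ℝ) ≤ S.card := by exact_mod_cast hc
    have hcf := sq_nonneg (coef p f S)
    rcases le_total m S.card with h | h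
    · have : coef p f S ^ 2 ≤ ((S.card : ℝ) * coef p f S ^ 2) / m := by
        rw [le_div_iff₀ hm0, mul_comm]
        exact mul_le_mul_of_nonneg_right (by exact_mod_cast h) hcf
      have : 0 ≤ (ρ ^ (2 * m))⁻¹ * ((S.card : ℝ) * (ρ ^ (2 * (S.card - 1)) * coef p f S ^ 2)) := by
        positivity
      linarith
    · have h3 : ρ ^ (2 * m) ≤ ρ ^ (2 * (S.card - 1)) :=
        pow_le_pow_of_le_one hρ0.le hρ1 (by omega)
      have h4 : 0 ≤ ((S.card : ℝ) * coef p f S ^ 2) / m := by positivity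
      have h5 : coef p f S ^ 2 ≤
          (ρ ^ (2 * m))⁻¹ * ((S.card : ℝ) * (ρ ^ (2 * (S.card - 1)) * coef p f S ^ 2)) := by
        rw [inv_mul_eq_div, le_div_iff₀ (by positivity)]
        calc coef p f S ^ 2 * ρ ^ (2 * m) ≤ coef p f S ^ 2 * ρ ^ (2 * (S.card - 1)) :=
              mul_le_mul_of_nonneg_left h3 hcf
          _ = 1 * (ρ ^ (2 * (S.card - 1)) * coef p f S ^ 2) := by ring
          _ ≤ _ := mul_le_mul_of_nonneg_right hc' (by positivity)
      linarith
  calc _ ≤ _ := Finset.sum_le_sum hpt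
    _ ≤ ∑ S : Finset ι, (((S.card : ℝ) * coef p f S ^ 2) / m +
      (ρ ^ (2 * m))⁻¹ * ((S.card : ℝ) * (ρ ^ (2 * (S.card - 1)) * coef p f S ^ 2))) := by
        refine Finset.sum_le_sum_of_subset_of_nonneg (Finset.erase_subset _ _) fun S _ _ => ?_
        positivity
    _ = (∑ S : Finset ι, (S.card : ℝ) * coef p f S ^ 2) / m + (ρ ^ (2 * m))⁻¹ *
        ∑ S : Finset ι, (S.card : ℝ) * (ρ ^ (2 * (S.card - 1)) * coef p f S ^ 2) := by
        rw [Finset.sum_add_distrib, Finset.sum_div, Finset.mul_sum]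
    _ ≤ _ := by
        gcongr

end Analysis

end HK

namespace HK

section Threshold

set_option linter.unusedSectionVars false

variable {ι : Type*} [Fintype ι] [DecidableEq ι]

lemma piv_01 {f : (ι → Bool) → ℝ} (hf01 : ∀ x, f x = 0 ∨ f x = 1) (hmono : Monotone f)
    (i : ι) (x : ι → Bool) : piv f i x = 0 ∨ piv f i x = 1 := by
  have h : f (Function.update x i false) ≤ f (Function.update x i true) := by
    apply hmono
    intro j
    by_cases hj : j = i
    · subst hj; simp
    · simp [hj]
  unfold piv
  rcases hf01 (Function.update x i false) with h1 | h1 <;>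
  rcases hf01 (Function.update x i true) with h2 | h2 <;>
  (rw [h1, h2] at h ⊢; first | (exfalso; linarith) | norm_num)

lemma Ex_le_of_le {f : (ι → Bool) → ℝ} (hf01 : ∀ x, f x = 0 ∨ f x = 1) (hmono : Monotone f)
    {a b : ℝ} (ha : 0 ≤ a) (hab : a ≤ b) (hb : b ≤ 1) : Ex a f ≤ Ex b f := by
  have : MonotoneOn (fun p => Ex p f) (Set.Icc 0 1) := by
    apply monotoneOn_of_deriv_nonneg (convex_Icc 0 1)
    · exact fun x _ => (russo f x).continuousAt.continuousWithinAt
    · exact fun x _ => (russo f x).differentiableAt.differentiableWithinAt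
    · intro x hx
      rw [interior_Icc] at hx
      rw [(russo f x).deriv]
      refine Finset.sum_nonneg fun i _ => Ex_nonneg hx.1.le hx.2.le fun y => ?_
      rcases piv_01 hf01 hmono i y with h | h <;> rw [h] <;> norm_num
  exact this ⟨ha, hab.trans hb⟩ ⟨ha.trans hab, hb⟩ hab

end Threshold

lemma sharp (p : ℝ) (hp : 1 / 2 < p) (hp1 : p < 1) (c ε : ℝ) (hc : 0 < c) (hε : 0 < ε) :
    ∃ N0 : ℕ, ∀ N : ℕ, N0 ≤ N → ∀ (ι : Type) [Fintype ι] [DecidableEq ι] (f : (ι → Bool) → ℝ),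
      (∀ x, f x = 0 ∨ f x = 1) → Monotone f →
      (∀ t : ℝ, 0 ≤ t → t ≤ 1 → ∀ i, (N : ℝ) ^ 2 * Ex t (piv f i) ≤ ∑ j, Ex t (piv f j)) →
      c ≤ Ex (1 / 2) f → 1 - ε < Ex p f := by
  set K : ℝ := 1 / (p - 1 / 2) with hK
  have hK0 : 0 < K := by rw [hK]; apply one_div_pos.mpr; linarith
  set v := c * ε with hv
  have hv0 : 0 < v := by positivity
  set s := p * (1 - p) with hs
  have hs0 : 0 < s := by rw [hs]; exact mul_pos (by linarith) (by linarith)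
  have hs4 : s ≤ 1 / 4 := by rw [hs]; nlinarith [sq_nonneg (p - 1 / 2)]
  obtain ⟨m, hm⟩ := exists_nat_gt (4 * K / v)
  set R := (s ^ (2 * (m + 1)))⁻¹ with hR
  have hR0 : 0 < R := by positivity
  obtain ⟨n, hn⟩ := exists_nat_gt (4 * (R * √K * K) / v)
  refine ⟨n + 1, fun N hN ι _ _ f hf01 hmono hsym hcf => ?_⟩
  by_contra hcon
  push Not at hcon
  have hN0 : (n : ℝ) + 1 ≤ N := by exact_mod_cast hN
  have hNpos : (0 : ℝ) < N := by have : (0 : ℝ) ≤ n := Nat.cast_nonneg n; linarith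
  obtain ⟨t, ht, htD⟩ := exists_hasDerivAt_eq_slope (fun p => Ex p f)
    (fun p => ∑ i, Ex p (piv f i)) hp
    (fun x _ => (russo f x).continuousAt.continuousWithinAt) (fun x _ => russo f x)
  set D := ∑ i, Ex t (piv f i) with hD
  have ht0 : 0 < t := by linarith [ht.1]
  have ht1 : t < 1 := by linarith [ht.2]
  have h1 : Ex (1 / 2) f ≤ Ex t f := Ex_le_of_le hf01 hmono (by norm_num) ht.1.le ht1.le
  have h2 : Ex t f ≤ Ex p f := Ex_le_of_le hf01 hmono ht0.le ht.2.le hp1.le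
  have hpiv0 : ∀ i x, 0 ≤ piv f i x := fun i x => by
    rcases piv_01 hf01 hmono i x with h | h <;> rw [h] <;> norm_num
  have hD0 : 0 ≤ D := Finset.sum_nonneg fun i _ => Ex_nonneg ht0.le ht1.le (hpiv0 i)
  have hDK : D ≤ K := by
    change D = _ at htD
    rw [htD, hK]
    apply div_le_div_of_nonneg_right _ (by linarith)
    linarith
  have hst : s ≤ t * (1 - t) := by rw [hs]; nlinarith [ht.1, ht.2]
  have hkkl := kkl ht0 ht1 hs0 (by nlinarith)
    (show 3 * s ^ 4 ≤ t * (1 - t) by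
      refine le_trans ?_ hst
      have : s ^ 3 ≤ (1 / 4) ^ 3 := pow_le_pow_left₀ hs0.le hs4 3
      nlinarith) f (fun x => by rcases hf01 x with h | h <;> rw [h] <;> norm_num)
    (piv_01 hf01 hmono) (√D / N) (by positivity)
    (fun i => by
      rw [div_pow, Real.sq_sqrt hD0, le_div_iff₀ (by positivity), mul_comm]
      exact hsym t ht0.le ht1.le i) (m + 1) (by omega)
  rw [← hD, ← hR] at hkkl
  have hvar : v ≤ Ex t f * (1 - Ex t f) := by
    rw [hv]
    exact mul_le_mul (hcf.trans h1) (by linarith) hε.le (by linarith)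
  have b1 : D / ((m + 1 : ℕ) : ℝ) ≤ v / 4 := by
    rw [div_le_iff₀ (by positivity)]
    rw [div_lt_iff₀ hv0] at hm
    push_cast
    nlinarith
  have b2 : R * (√D / N * D) ≤ v / 4 := by
    have : R * (√D / N * D) = (R * √D * D) / N := by ring
    rw [this, div_le_iff₀ hNpos]
    rw [div_lt_iff₀ hv0] at hn
    have h3 : R * √D * D ≤ R * √K * K := by gcongr
    nlinarith
  linarith

section Sym

set_option linter.unusedSectionVars false
variable {ι κ : Type*} [Fintype ι] [Fintype κ] [DecidableEq ι] [DecidableEq κ]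

lemma Ex_equiv (p : ℝ) (τ : ι ≃ κ) (f : (ι → Bool) → ℝ) :
    Ex p (fun x : κ → Bool => f (fun i => x (τ i))) = Ex p f := by
  unfold Ex
  refine Fintype.sum_equiv (Equiv.arrowCongr τ.symm (Equiv.refl Bool)) _ _ fun x => ?_
  have e : (Equiv.arrowCongr τ.symm (Equiv.refl Bool)) x = fun i => x (τ i) := by
    funext i; simp [Equiv.arrowCongr]
  rw [e]
  congr 1
  unfold mu
  exact (Equiv.prod_comp τ (fun k => wt p (x k))).symm

lemma Ex_compl (p : ℝ) (f : (ι → Bool) → ℝ) :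
    Ex p (fun x : ι → Bool => f (fun i => !x i)) = Ex (1 - p) f := by
  unfold Ex
  have hinv : Function.Involutive (fun (x : ι → Bool) i => !x i) := fun x => by simp
  refine Fintype.sum_equiv hinv.toPerm _ _ fun x => ?_
  simp only [Function.Involutive.coe_toPerm]
  congr 1
  unfold mu
  refine Finset.prod_congr rfl fun i _ => ?_
  change wt p (x i) = wt (1 - p) (!x i)
  cases x i <;> simp [wt]

lemma piv_equiv (p : ℝ) (τ : ι ≃ ι) (f : (ι → Bool) → ℝ)
    (hf : ∀ x, f (fun i => x (τ i)) = f x) (i : ι) : Ex p (piv f (τ i)) = Ex p (piv f i) := by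
  rw [← Ex_equiv p τ (piv f i)]
  congr 1
  funext x
  have : ∀ b, Function.update (fun j => x (τ j)) i b
      = fun j => Function.update x (τ i) b (τ j) := by
    intro b; funext j
    by_cases h : j = i
    · subst h; simp
    · simp [h]
  simp only [piv, this, hf]

open Classical in
/-- indicator -/
noncomputable def ind (S : Set (ι → Bool)) (x : ι → Bool) : ℝ := if x ∈ S then 1 else 0

lemma ind_01 (S : Set (ι → Bool)) (x : ι → Bool) : ind S x = 0 ∨ ind S x = 1 := by
  unfold ind; split_ifs <;> simp

lemma ind_nonneg (S : Set (ι → Bool)) (x : ι → Bool) : 0 ≤ ind S x := by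
  rcases ind_01 S x with h | h <;> rw [h] <;> norm_num

lemma ind_le {S T : Set (ι → Bool)} {x y : ι → Bool} (h : x ∈ S → y ∈ T) : ind S x ≤ ind T y := by
  unfold ind; split_ifs <;> simp_all

lemma harris_half (S T : Set (ι → Bool)) (hS : IsUpperSet S) (hT : IsUpperSet T) :
    Ex (1 / 2) (ind S) * Ex (1 / 2) (ind T) ≤ Ex (1 / 2) (ind (S ∩ T)) := by
  have hf := fkg (μ := fun x : ι → Bool => mu (1 / 2) x) (f := ind S) (g := ind T)
    (fun x => mu_nonneg (by norm_num) (by norm_num) x) (ind_nonneg S) (ind_nonneg T)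
    (fun x y h => ind_le fun hx => hS h hx) (fun x y h => ind_le fun hx => hT h hx)
    (fun a b => by
      have : ∀ x : ι → Bool, mu (1 / 2) x = ∏ _i : ι, (1 / 2 : ℝ) := fun x =>
        Finset.prod_congr rfl fun i _ => by unfold wt; split_ifs <;> norm_num
      simp only [this]; exact le_rfl)
  rw [sum_mu, one_mul] at hf
  have e : ∀ x, ind (S ∩ T) x = ind S x * ind T x := by
    intro x; unfold ind
    by_cases h1 : x ∈ S <;> by_cases h2 : x ∈ T <;> simp [h1, h2]
  simp only [Ex, e]
  exact hf

end Sym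

lemma prob_eq (N : ℕ) [NeZero N] (p : ℝ) (S : Set (TorusPerc.Config 2 N)) :
    TorusPerc.prob 2 N p S = Ex p (ind S) := by
  classical
  unfold TorusPerc.prob Ex
  rw [finsum_mem_def, finsum_eq_sum_of_fintype]
  refine Finset.sum_congr rfl fun x _ => ?_
  unfold Set.indicator ind
  split_ifs
  · simp [mu, wt, finprod_eq_prod_of_fintype]
  · simp

end HK

namespace HK

open TorusPerc

section Topology

variable {N : ℕ}

/-- basis vector of the torus -/
def tv (N : ℕ) (i : Fin 2) : Fin 2 → ZMod N := fun j => if j = i then 1 else 0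

lemma proj_add_std (x : Fin 2 → ℤ) (i : Fin 2) :
    proj 2 N (x + stdVec 2 i) = proj 2 N x + tv N i := by
  funext j
  simp only [proj, stdVec, tv, Pi.add_apply]
  split_ifs <;> simp

lemma proj_add_smul (x w : Fin 2 → ℤ) : proj 2 N (x + (N : ℤ) • w) = proj 2 N x := by
  funext j
  simp [proj]

lemma exists_of_proj_eq {x y : Fin 2 → ℤ} (h : proj 2 N x = proj 2 N y) :
    ∃ w : Fin 2 → ℤ, y = x + (N : ℤ) • w := by
  have h1 : ∀ i, (N : ℤ) ∣ y i - x i := fun i =>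
    (ZMod.intCast_eq_intCast_iff_dvd_sub _ _ _).mp (congrFun h i)
  choose w hw using h1
  refine ⟨w, ?_⟩
  funext i
  simp only [Pi.add_apply, Pi.smul_apply, smul_eq_mul]
  linarith [hw i]

lemma step_symm {ω : Config 2 N} {x y : Fin 2 → ℤ} (h : step 2 N ω x y) : step 2 N ω y x :=
  Or.symm h

lemma conn_symm {ω : Config 2 N} {x y : Fin 2 → ℤ} (h : connected 2 N ω x y) :
    connected 2 N ω y x := by
  induction h with
  | refl => exact Relation.ReflTransGen.refl
  | tail _ h ih => exact Relation.ReflTransGen.head (step_symm h) ih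

/-- transport of connections along a map of the plane -/
lemma conn_map {ω ω' : Config 2 N} (f : (Fin 2 → ℤ) → (Fin 2 → ℤ))
    (hf : ∀ x i, liftOpen 2 N ω x i → step 2 N ω' (f x) (f (x + stdVec 2 i)))
    {x y : Fin 2 → ℤ} (h : connected 2 N ω x y) : connected 2 N ω' (f x) (f y) := by
  have hst : ∀ a b, step 2 N ω a b → step 2 N ω' (f a) (f b) := by
    rintro a b (⟨i, rfl, h⟩ | ⟨i, rfl, h⟩)
    · exact hf a i h
    · exact step_symm (hf b i h)
  induction h with
  | refl => exact Relation.ReflTransGen.refl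
  | tail _ h ih => exact Relation.ReflTransGen.tail ih (hst _ _ h)

lemma conn_translate {ω : Config 2 N} {x y : Fin 2 → ℤ} (w : Fin 2 → ℤ)
    (h : connected 2 N ω x y) : connected 2 N ω (x + (N : ℤ) • w) (y + (N : ℤ) • w) := by
  refine conn_map (fun x => x + (N : ℤ) • w) ?_ h
  intro x i hx
  left
  refine ⟨i, by abel, ?_⟩
  unfold liftOpen
  rw [proj_add_smul]
  exact hx

lemma giant_iff [NeZero N] {ω : Config 2 N} :
    ω ∈ giantEvent 2 N ↔ ∃ w ∈ winding 2 N ω, w ≠ 0 := by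
  constructor
  · rintro ⟨x, y, hne, hp, hc⟩
    obtain ⟨w, rfl⟩ := exists_of_proj_eq hp
    refine ⟨w, ⟨x, hc⟩, ?_⟩
    rintro rfl
    simp at hne
  · rintro ⟨w, ⟨x, hx⟩, hw⟩
    refine ⟨x, x + (N : ℤ) • w, ?_, (proj_add_smul x w).symm, hx⟩
    intro h
    have h2 : (N : ℤ) • w = 0 := by simpa using h
    rcases smul_eq_zero.mp h2 with h3 | h3
    · exact NeZero.ne N (by exact_mod_cast h3)
    · exact hw h3

lemma exists_rep {ω : Config 2 N} (hA : ω ∉ giantEvent 2 N) :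
    ∃ rp : (Fin 2 → ℤ) → (Fin 2 → ℤ),
      (∀ x y, connected 2 N ω x y → rp x = rp y) ∧
      (∀ x w, rp (x + (N : ℤ) • w) = rp x + (N : ℤ) • w) := by
  let st : Setoid (Fin 2 → ℤ) :=
    { r := fun x y => ∃ u : Fin 2 → ℤ, connected 2 N ω x (y + (N : ℤ) • u)
      iseqv := by
        refine ⟨fun x => ⟨0, by rw [smul_zero, add_zero]; exact Relation.ReflTransGen.refl⟩, ?_, ?_⟩
        · rintro x y ⟨u, hu⟩
          refine ⟨-u, ?_⟩
          have := conn_translate (-u) (conn_symm hu)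
          simpa using this
        · rintro x y z ⟨u, hu⟩ ⟨v, hv⟩
          refine ⟨v + u, ?_⟩
          have := conn_translate u hv
          refine Relation.ReflTransGen.trans hu ?_
          rwa [add_assoc, ← smul_add] at this }
  let q : (Fin 2 → ℤ) → (Fin 2 → ℤ) := fun x => (Quotient.mk st x).out
  have hq : ∀ x, ∃ u : Fin 2 → ℤ, connected 2 N ω x (q x + (N : ℤ) • u) := fun x =>
    st.symm (Quotient.mk_out x)
  choose u hu using hq
  have hqeq : ∀ x y, (∃ u : Fin 2 → ℤ, connected 2 N ω x (y + (N : ℤ) • u)) → q x = q y := by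
    intro x y h
    have : Quotient.mk st x = Quotient.mk st y := Quotient.sound h
    simp only [q, this]
  have huniq : ∀ a u v : Fin 2 → ℤ, connected 2 N ω (a + (N : ℤ) • u) (a + (N : ℤ) • v) →
      a + (N : ℤ) • u = a + (N : ℤ) • v := by
    intro a u v h
    by_contra hne
    exact hA ⟨_, _, hne, by rw [proj_add_smul, proj_add_smul], h⟩
  refine ⟨fun x => q x + (N : ℤ) • u x, ?_, ?_⟩
  · intro x y h
    have e : q x = q y := hqeq x y ⟨0, by simpa using h⟩
    have h1 : connected 2 N ω (q x + (N : ℤ) • u x) (q x + (N : ℤ) • u y) := by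
      refine Relation.ReflTransGen.trans (conn_symm (hu x)) (Relation.ReflTransGen.trans h ?_)
      rw [e]; exact hu y
    have := huniq _ _ _ h1
    change q x + (N : ℤ) • u x = q y + (N : ℤ) • u y
    rw [this, e]
  · intro x w
    have e : q (x + (N : ℤ) • w) = q x :=
      hqeq _ _ ⟨w, Relation.ReflTransGen.refl⟩
    have h1 : connected 2 N ω (q x + (N : ℤ) • u (x + (N : ℤ) • w)) (q x + (N : ℤ) • (u x + w)) := by
      have h2 := hu (x + (N : ℤ) • w)
      rw [e] at h2
      refine Relation.ReflTransGen.trans (conn_symm h2) ?_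
      have h3 := conn_translate w (hu x)
      rwa [add_assoc, ← smul_add] at h3
    have := huniq _ _ _ h1
    change q (x + (N : ℤ) • w) + (N : ℤ) • u (x + (N : ℤ) • w) = q x + (N : ℤ) • u x + (N : ℤ) • w
    rw [e, this, smul_add, add_assoc]

lemma exists_pot [NeZero N] {ω : Config 2 N} (hA : ω ∉ giantEvent 2 N) (i : Fin 2) :
    ∃ g : (Fin 2 → ZMod N) → ℤ, ∀ v j, ω (v, j) = true →
      g (v + tv N j) - g v + (if i = j then 1 else 0) = 0 := by
  obtain ⟨rp, h1, h2⟩ := exists_rep hA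
  let lift : (Fin 2 → ZMod N) → (Fin 2 → ℤ) := fun v k => ((v k).val : ℤ)
  have hl : ∀ v, proj 2 N (lift v) = v := by
    intro v; funext k; simp [proj, lift]
  let g : (Fin 2 → ZMod N) → ℤ := fun v => rp (lift v) i - lift v i
  have hg : ∀ x, g (proj 2 N x) = rp x i - x i := by
    intro x
    obtain ⟨w, hw⟩ := exists_of_proj_eq (N := N) (hl (proj 2 N x)).symm
    simp only [g]
    rw [hw, h2]
    simp
  refine ⟨g, fun v j hv => ?_⟩
  have e1 : v + tv N j = proj 2 N (lift v + stdVec 2 j) := by rw [proj_add_std, hl]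
  have hst : rp (lift v) = rp (lift v + stdVec 2 j) := by
    apply h1
    apply Relation.ReflTransGen.single
    left
    refine ⟨j, rfl, ?_⟩
    unfold liftOpen
    rw [hl]; exact hv
  rw [e1, hg, ← hst]
  simp only [g, stdVec, Pi.add_apply]
  ring

/-- The edge of the dual lattice, as an index shift. -/
def dualEdge (N : ℕ) : Edge 2 N ≃ Edge 2 N where
  toFun e := (e.1 + tv N e.2, e.2.rev)
  invFun e := (e.1 - tv N e.2.rev, e.2.rev)
  left_inv e := by ext <;> simp
  right_inv e := by ext <;> simp

/-- Dual configuration. -/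
def dual (ω : Config 2 N) : Config 2 N := fun e => !ω (dualEdge N e)

lemma giant_or_dual [NeZero N] (ω : Config 2 N) :
    ω ∈ giantEvent 2 N ∨ dual ω ∈ giantEvent 2 N := by
  by_contra hcon
  push Not at hcon
  obtain ⟨φ, hφ⟩ := exists_pot hcon.1 0
  obtain ⟨ψ, hψ⟩ := exists_pot hcon.2 1
  set e0 := tv N 0
  set e1 := tv N 1
  have k1 : ∀ v, (φ (v + e0) - φ v + 1) * (ψ v - ψ (v - e1) + 1) = 0 := by
    intro v
    cases h : ω (v, 0)
    · have := hψ (v - e1) 1 (by simp [dual, dualEdge, e1, h])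
      simp only [if_true] at this
      change ψ (v - e1 + e1) - _ + 1 = 0 at this
      rw [sub_add_cancel] at this
      rw [this, mul_zero]
    · have := hφ v 0 h
      simp only [if_true] at this
      change φ (v + e0) - _ + 1 = 0 at this
      rw [this, zero_mul]
  have k2 : ∀ v, (φ (v + e1) - φ v) * (ψ v - ψ (v - e0)) = 0 := by
    intro v
    cases h : ω (v, 1)
    · have := hψ (v - e0) 0 (by simp [dual, dualEdge, e0, h])
      simp at this
      change ψ (v - e0 + e0) - _ = 0 at this
      rw [sub_add_cancel] at this
      rw [this, mul_zero]
    · have := hφ v 1 h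
      simp at this
      change φ (v + e1) - _ = 0 at this
      rw [this, zero_mul]
  have shift : ∀ (F : (Fin 2 → ZMod N) → ℤ) (a), ∑ v, F (v + a) = ∑ v, F v := fun F a =>
    Equiv.sum_comp (Equiv.addRight a) F
  have s1 := shift φ e0
  have s2 := shift (fun v => ψ (v - e1)) e1
  have s3 := shift (fun v => φ v * ψ (v - e0)) e0
  have s4 := shift (fun v => φ v * ψ (v - e1)) e1
  have s5 := shift (fun v => φ (v + e1) * ψ (v - e0)) (e0 - e1)
  simp only [add_sub_cancel_right] at s2 s3 s4
  have r1 : ∀ v, v + (e0 - e1) + e1 = v + e0 := fun v => by abel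
  have r2 : ∀ v, v + (e0 - e1) - e0 = v - e1 := fun v => by abel
  simp only [r1, r2] at s5
  have tot : ∑ v, ((φ (v + e0) - φ v + 1) * (ψ v - ψ (v - e1) + 1)
      - (φ (v + e1) - φ v) * (ψ v - ψ (v - e0))) = 0 :=
    Finset.sum_eq_zero fun v _ => by rw [k1, k2, sub_zero]
  have ex : ∀ v, (φ (v + e0) - φ v + 1) * (ψ v - ψ (v - e1) + 1)
      - (φ (v + e1) - φ v) * (ψ v - ψ (v - e0))
      = (φ (v + e0) * ψ v - φ v * ψ (v - e0)) - (φ (v + e1) * ψ v - φ v * ψ (v - e1))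
        - (φ (v + e0) * ψ (v - e1) - φ (v + e1) * ψ (v - e0))
        + (φ (v + e0) - φ v) + (ψ v - ψ (v - e1)) + 1 := fun v => by ring
  simp only [ex, Finset.sum_add_distrib, Finset.sum_sub_distrib, s1, s2, s3, s4, s5] at tot
  simp at tot
  exact NeZero.ne N tot

lemma exists_flow [NeZero N] {ω : Config 2 N} {x y : Fin 2 → ℤ} (h : connected 2 N ω x y) :
    ∃ c : Edge 2 N → ℤ, (∀ e, ω e = false → c e = 0) ∧
      (∀ v, ∑ i, (c (v, i) - c (v - tv N i, i))
        = (if v = proj 2 N x then 1 else 0) - (if v = proj 2 N y then 1 else 0)) ∧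
      (∀ i, ∑ v, c (v, i) = y i - x i) := by
  -- the flow of a single edge
  have single : ∀ (a : Fin 2 → ZMod N) (j : Fin 2), ∀ v,
      ∑ i, ((if ((v, i) : Edge 2 N) = (a, j) then (1 : ℤ) else 0)
        - (if ((v - tv N i, i) : Edge 2 N) = (a, j) then 1 else 0))
      = (if v = a then 1 else 0) - (if v = a + tv N j then 1 else 0) := by
    intro a j v
    rw [Finset.sum_eq_single j]
    · simp [sub_eq_iff_eq_add]
    · intro b _ hb; simp [hb]
    · simp
  have single2 : ∀ (a : Fin 2 → ZMod N) (j i : Fin 2),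
      ∑ v, (if ((v, i) : Edge 2 N) = (a, j) then (1 : ℤ) else 0) = stdVec 2 j i := by
    intro a j i
    by_cases hij : i = j
    · simp [hij, stdVec]
    · simp [hij, stdVec]
  induction h with
  | refl => exact ⟨fun _ => 0, by simp, by simp, by simp⟩
  | tail _ hs ih =>
    obtain ⟨c, hc1, hc2, hc3⟩ := ih
    rcases hs with ⟨j, rfl, ho⟩ | ⟨j, rfl, ho⟩
    · rename_i b _
      refine ⟨fun e => c e + (if e = (proj 2 N b, j) then 1 else 0), ?_, ?_, ?_⟩
      · intro e he
        have : e ≠ (proj 2 N b, j) := by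
          rintro rfl; unfold liftOpen at ho; rw [ho] at he; simp at he
        simp [this, hc1 e he]
      · intro v
        have e1 := hc2 v
        have e2 := single (proj 2 N b) j v
        rw [proj_add_std]
        simp only [Finset.sum_sub_distrib, Finset.sum_add_distrib] at e1 e2 ⊢
        linarith
      · intro i
        rw [Finset.sum_add_distrib, hc3, single2]
        simp only [Pi.add_apply]; ring
    · rename_i z _
      refine ⟨fun e => c e - (if e = (proj 2 N z, j) then 1 else 0), ?_, ?_, ?_⟩
      · intro e he
        have : e ≠ (proj 2 N z, j) := by
          rintro rfl; unfold liftOpen at ho; rw [ho] at he; simp at he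
        simp [this, hc1 e he]
      · intro v
        have e1 := hc2 v
        have e2 := single (proj 2 N z) j v
        rw [proj_add_std] at e1
        simp only [Finset.sum_sub_distrib] at e1 e2 ⊢
        linarith
      · intro i
        rw [Finset.sum_sub_distrib, hc3, single2]
        simp only [Pi.add_apply]; ring

end Topology

end HK

namespace HK

open TorusPerc

section Intersection

lemma antidiff (a : ℤ → ℤ) : ∃ F : ℤ → ℤ, ∀ n, F (n + 1) - F n = a n := by
  let F : ℤ → ℤ := fun n => ∑ k ∈ Finset.range n.toNat, a k
    - ∑ k ∈ Finset.range (-n).toNat, a (-(k : ℤ) - 1)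
  refine ⟨F, fun n => ?_⟩
  rcases le_or_gt 0 n with h | h
  · obtain ⟨m, rfl⟩ := Int.eq_ofNat_of_zero_le h
    have e1 : ((m : ℤ) + 1).toNat = m + 1 := by omega
    have e2 : (-((m : ℤ) + 1)).toNat = 0 := by omega
    have e3 : (-(m : ℤ)).toNat = 0 := by omega
    simp only [F, e1, e2, e3, Int.toNat_natCast, Finset.sum_range_succ]
    simp
  · obtain ⟨m, hm⟩ : ∃ m : ℕ, n = -(m : ℤ) - 1 := ⟨(-n - 1).toNat, by omega⟩
    subst hm
    have e1 : (-(m : ℤ) - 1 + 1).toNat = 0 := by omega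
    have e2 : (-(-(m : ℤ) - 1 + 1)).toNat = m := by omega
    have e3 : (-(m : ℤ) - 1).toNat = 0 := by omega
    have e4 : (-(-(m : ℤ) - 1)).toNat = m + 1 := by omega
    simp only [F, e1, e2, e3, e4, Finset.sum_range_succ]
    simp

lemma const_of_diff {g : ℤ → ℤ} (h : ∀ n, g (n + 1) = g n) (n : ℤ) : g n = g 0 := by
  induction n using Int.induction_on with
  | zero => rfl
  | succ i ih => rw [h, ih]
  | pred i ih => rw [← ih, ← h (-(i : ℤ) - 1)]; congr 1; ring

lemma const_of_diff2 {g : ℤ → ℤ → ℤ} (h : ∀ a b, g (a + 1) b = g a b)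
    (h' : ∀ a b, g a (b + 1) = g a b) (a b : ℤ) : g a b = g 0 0 := by
  rw [const_of_diff (g := fun a => g a b) (fun n => h n b) a]
  exact const_of_diff (g := fun b => g 0 b) (fun n => h' 0 n) b

lemma potential (P Q : ℤ → ℤ → ℤ) (h : ∀ a b, P a (b + 1) - P a b = Q (a + 1) b - Q a b) :
    ∃ H : ℤ → ℤ → ℤ, (∀ a b, H (a + 1) b - H a b = P a b) ∧
      (∀ a b, H a (b + 1) - H a b = Q a b) := by
  obtain ⟨A, hA⟩ := antidiff (fun a => P a 0)
  have hB := fun a => antidiff (fun b => Q a b)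
  choose B hB using hB
  refine ⟨fun a b => A a + (B a b - B a 0), ?_, ?_⟩
  · intro a b
    have := const_of_diff (g := fun b => A (a + 1) + (B (a + 1) b - B (a + 1) 0)
      - (A a + (B a b - B a 0)) - P a b) (fun n => by
        have h1 := hB (a + 1) n
        have h2 := hB a n
        have h3 := h a n
        linarith) b
    have h1 := hA a
    linarith
  · intro a b
    have := hB a b
    linarith

lemma sum_zmod (N : ℕ) [NeZero N] (F : ZMod N → ℤ) :
    ∑ z, F z = ∑ a ∈ Finset.range N, F (a : ℕ) := by
  refine Finset.sum_nbij' (fun z => z.val) (fun a => (a : ZMod N)) ?_ ?_ ?_ ?_ ?_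
  · intro z _; simpa using ZMod.val_lt z
  · intro a _; simp
  · intro z _; simp
  · intro a ha; simp at ha; exact ZMod.val_cast_of_lt ha
  · intro z _; simp

lemma sum_torus (N : ℕ) [NeZero N] (F : (Fin 2 → ZMod N) → ℤ) :
    ∑ v, F v = ∑ a ∈ Finset.range N, ∑ b ∈ Finset.range N, F ![(a : ZMod N), (b : ZMod N)] := by
  rw [← Equiv.sum_comp (finTwoArrowEquiv (ZMod N)).symm F, Fintype.sum_prod_type, sum_zmod]
  refine Finset.sum_congr rfl fun a _ => ?_
  rw [sum_zmod]
  rfl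

variable {N : ℕ}

lemma winding_det [NeZero N] {ω : Config 2 N} {w v : Fin 2 → ℤ} (hw : w ∈ winding 2 N ω)
    (hv : v ∈ winding 2 N (dual ω)) : w 0 * v 1 - w 1 * v 0 = 0 := by
  obtain ⟨x, hx⟩ := hw
  obtain ⟨y, hy⟩ := hv
  obtain ⟨c, hc1, hc2, hc3⟩ := exists_flow hx
  have hN : (N : ℤ) ≠ 0 := by exact_mod_cast NeZero.ne N
  -- lifted flow
  set C : Fin 2 → ℤ → ℤ → ℤ := fun i a b => c (![(a : ZMod N), (b : ZMod N)], i) with hC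
  have hdiv : ∀ a b, C 0 (a + 1) (b + 1) - C 0 a (b + 1)
      + (C 1 (a + 1) (b + 1) - C 1 (a + 1) b) = 0 := by
    intro a b
    have := hc2 ![((a + 1 : ℤ) : ZMod N), ((b + 1 : ℤ) : ZMod N)]
    rw [proj_add_smul, sub_self, Fin.sum_univ_two] at this
    have e0 : ![((a + 1 : ℤ) : ZMod N), ((b + 1 : ℤ) : ZMod N)] - tv N 0
        = ![(a : ZMod N), ((b + 1 : ℤ) : ZMod N)] := by
      funext k; fin_cases k <;> simp [tv]
    have e1 : ![((a + 1 : ℤ) : ZMod N), ((b + 1 : ℤ) : ZMod N)] - tv N 1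
        = ![((a + 1 : ℤ) : ZMod N), (b : ZMod N)] := by
      funext k; fin_cases k <;> simp [tv]
    rw [e0, e1] at this
    exact this
  obtain ⟨H, hH0, hH1⟩ := potential (fun a b => - C 1 (a + 1) b) (fun a b => C 0 a (b + 1))
    (fun a b => by have := hdiv a b; linarith)
  have per0 : ∀ i a b, C i (a + N) b = C i a b := by intro i a b; simp [hC]
  have per1 : ∀ i a b, C i a (b + N) = C i a b := by intro i a b; simp [hC]
  -- the two periods
  have q0 : ∀ a b, H (a + N) b - H a b = H (0 + N) 0 - H 0 0 := by
    intro a b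
    refine const_of_diff2 (g := fun a b => H (a + N) b - H a b) ?_ ?_ a b
    · intro a b
      have h1 := hH0 (a + N) b
      have h2 := hH0 a b
      have h3 := per0 1 (a + 1) b
      rw [add_right_comm] at h1
      linarith
    · intro a b
      have h1 := hH1 (a + N) b
      have h2 := hH1 a b
      have h3 := per0 0 a (b + 1)
      linarith
  have q1 : ∀ a b, H a (b + N) - H a b = H 0 (0 + N) - H 0 0 := by
    intro a b
    refine const_of_diff2 (g := fun a b => H a (b + N) - H a b) ?_ ?_ a b
    · intro a b
      have h1 := hH0 a (b + N)
      have h2 := hH0 a b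
      have h3 := per1 1 (a + 1) b
      linarith
    · intro a b
      have h1 := hH1 a (b + N)
      have h2 := hH1 a b
      have h3 := per1 0 a (b + 1)
      rw [add_right_comm] at h1
      linarith
  set P0 := H (0 + N) 0 - H 0 0
  set P1 := H 0 (0 + N) - H 0 0
  -- values of the periods
  have v1 : P1 = w 0 := by
    have t := hc3 0
    rw [sum_torus] at t
    have e : ∀ a ∈ Finset.range N, ∑ b ∈ Finset.range N, c (![(a : ZMod N), (b : ZMod N)], 0) = P1 := by
      intro a _
      have tel : ∀ b : ℕ, c (![(a : ZMod N), (b : ZMod N)], 0)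
          = (fun b : ℕ => H a ((b : ℤ) - 1)) (b + 1) - (fun b : ℕ => H a ((b : ℤ) - 1)) b := by
        intro b
        have := hH1 a ((b : ℤ) - 1)
        simp only [sub_add_cancel, hC, Int.cast_natCast] at this
        push_cast
        rw [add_sub_cancel_right]
        exact this.symm
      rw [Finset.sum_congr rfl fun b _ => tel b, Finset.sum_range_sub (fun b : ℕ => H a ((b : ℤ) - 1)) N]
      have := q1 a (-1)
      rw [← this]
      simp only [Nat.cast_zero, zero_sub]
      rw [neg_add_eq_sub]
    rw [Finset.sum_congr rfl e] at t
    simp at t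
    rcases t with t | t
    · exact t
    · exact absurd t (NeZero.ne N)
  have v0 : P0 = - w 1 := by
    have t := hc3 1
    rw [sum_torus, Finset.sum_comm] at t
    have e : ∀ b ∈ Finset.range N, ∑ a ∈ Finset.range N, c (![(a : ZMod N), (b : ZMod N)], 1) = -P0 := by
      intro b _
      have tel : ∀ a : ℕ, c (![(a : ZMod N), (b : ZMod N)], 1)
          = (fun a : ℕ => - H ((a : ℤ) - 1) b) (a + 1) - (fun a : ℕ => - H ((a : ℤ) - 1) b) a := by
        intro a
        have := hH0 ((a : ℤ) - 1) b
        simp only [sub_add_cancel, hC, Int.cast_natCast] at this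
        push_cast
        rw [add_sub_cancel_right]
        linarith
      rw [Finset.sum_congr rfl fun a _ => tel a, Finset.sum_range_sub (fun a : ℕ => - H ((a : ℤ) - 1) b) N]
      have := q0 (-1) b
      rw [← this]
      simp only [Nat.cast_zero, zero_sub]
      rw [neg_add_eq_sub]
      ring
    rw [Finset.sum_congr rfl e] at t
    simp at t
    have t' : (N : ℤ) * (-P0) = N * w 1 := by linarith
    have := mul_left_cancel₀ hN t'
    linarith
  -- constant on dual clusters
  have hconst : ∀ z, connected 2 N (dual ω) y z → H (z 0) (z 1) = H (y 0) (y 1) := by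
    have hst : ∀ z i, liftOpen 2 N (dual ω) z i →
        H ((z + stdVec 2 i) 0) ((z + stdVec 2 i) 1) = H (z 0) (z 1) := by
      intro z i hz
      unfold liftOpen dual at hz
      simp only [Bool.not_eq_true'] at hz
      have hz' := hc1 _ hz
      fin_cases i
      · have h1 := hH0 (z 0) (z 1)
        have e : C 1 (z 0 + 1) (z 1) = 0 := by
          rw [← hz', hC]
          simp only [dualEdge, Equiv.coe_fn_mk]
          congr 2
          funext k; fin_cases k <;> simp [proj, tv]
        rw [e] at h1
        simp [stdVec]
        linarith
      · have h1 := hH1 (z 0) (z 1)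
        have e : C 0 (z 0) (z 1 + 1) = 0 := by
          rw [← hz', hC]
          simp only [dualEdge, Equiv.coe_fn_mk]
          congr 2
          funext k; fin_cases k <;> simp [proj, tv]
        rw [e] at h1
        simp [stdVec]
        linarith
    intro z hz
    induction hz with
    | refl => rfl
    | tail _ hs ih =>
      rcases hs with ⟨j, rfl, ho⟩ | ⟨j, rfl, ho⟩
      · rw [hst _ _ ho, ih]
      · rw [← ih, hst _ _ ho]
  have hfin := hconst _ hy
  have m0 : ∀ k a b, H (a + N * k) b = H a b + k * P0 := by
    intro k a b
    have := const_of_diff (g := fun k => H (a + N * k) b - k * P0) (fun n => by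
      have := q0 (a + N * n) b
      have e : a + (N : ℤ) * (n + 1) = a + N * n + N := by ring
      simp only [e]
      linarith) k
    simp at this
    linarith
  have m1 : ∀ k a b, H a (b + N * k) = H a b + k * P1 := by
    intro k a b
    have := const_of_diff (g := fun k => H a (b + N * k) - k * P1) (fun n => by
      have := q1 a (b + N * n)
      have e : b + (N : ℤ) * (n + 1) = b + N * n + N := by ring
      simp only [e]
      linarith) k
    simp at this
    linarith
  simp only [Pi.add_apply, Pi.smul_apply, smul_eq_mul, m0, m1, v0, v1] at hfin
  linarith

lemma giant_dual_not_span [NeZero N] {ω : Config 2 N} (h : ω ∈ giantEvent 2 N) :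
    dual ω ∉ spanEvent 2 N := by
  obtain ⟨w, hw, hw0⟩ := giant_iff.mp h
  intro hs
  change Submodule.span ℚ _ = ⊤ at hs
  let L : (Fin 2 → ℚ) →ₗ[ℚ] ℚ :=
    (w 0 : ℚ) • LinearMap.proj 1 - (w 1 : ℚ) • LinearMap.proj 0
  have hle : Submodule.span ℚ (windingQ 2 N (dual ω)) ≤ LinearMap.ker L := by
    rw [Submodule.span_le]
    rintro _ ⟨v, hv, rfl⟩
    have := winding_det hw hv
    simp [L]
    exact_mod_cast this
  rw [hs] at hle
  have := hle (Submodule.mem_top : (![-(w 1 : ℚ), (w 0 : ℚ)] : Fin 2 → ℚ) ∈ ⊤)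
  simp [L] at this
  have h0 : (w 0 : ℚ) = 0 := by nlinarith
  have h1 : (w 1 : ℚ) = 0 := by nlinarith
  apply hw0
  funext k
  fin_cases k
  · exact_mod_cast h0
  · exact_mod_cast h1

lemma span_of_det {ω : Config 2 N} {w v : Fin 2 → ℤ} (hw : w ∈ winding 2 N ω)
    (hv : v ∈ winding 2 N ω) (hd : w 0 * v 1 - w 1 * v 0 ≠ 0) : ω ∈ spanEvent 2 N := by
  change Submodule.span ℚ _ = ⊤
  rw [eq_top_iff]
  intro z _
  have hd' : (w 0 : ℚ) * v 1 - w 1 * v 0 ≠ 0 := by exact_mod_cast hd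
  have e : z = ((z 0 * v 1 - z 1 * v 0) / ((w 0 : ℚ) * v 1 - w 1 * v 0)) • (fun i => (w i : ℚ))
      + ((w 0 * z 1 - w 1 * z 0) / ((w 0 : ℚ) * v 1 - w 1 * v 0)) • (fun i => (v i : ℚ)) := by
    funext k
    fin_cases k
    · simp only [Pi.add_apply, Pi.smul_apply, smul_eq_mul]
      rw [div_mul_eq_mul_div, div_mul_eq_mul_div, ← add_div, eq_div_iff hd']
      simp only [Fin.zero_eta, Fin.mk_one, Fin.isValue]
      ring
    · simp only [Pi.add_apply, Pi.smul_apply, smul_eq_mul]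
      rw [div_mul_eq_mul_div, div_mul_eq_mul_div, ← add_div, eq_div_iff hd']
      simp only [Fin.zero_eta, Fin.mk_one, Fin.isValue]
      ring
  rw [e]
  exact Submodule.add_mem _ (Submodule.smul_mem _ _ (Submodule.subset_span ⟨w, hw, rfl⟩))
    (Submodule.smul_mem _ _ (Submodule.subset_span ⟨v, hv, rfl⟩))

end Intersection

end HK

namespace HK

open TorusPerc

section Final

variable {N : ℕ}

lemma winding_map {ω ω' : Config 2 N} (f L : (Fin 2 → ℤ) → (Fin 2 → ℤ))
    (hf : ∀ x i, liftOpen 2 N ω x i → step 2 N ω' (f x) (f (x + stdVec 2 i)))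
    (hL : ∀ x w, f (x + (N : ℤ) • w) = f x + (N : ℤ) • L w) {w : Fin 2 → ℤ}
    (h : w ∈ winding 2 N ω) : L w ∈ winding 2 N ω' := by
  obtain ⟨x, hx⟩ := h
  refine ⟨f x, ?_⟩
  rw [← hL]
  exact conn_map f hf hx

lemma winding_mono {ω ω' : Config 2 N} (h : ω ≤ ω') : winding 2 N ω ⊆ winding 2 N ω' := by
  intro w hw
  refine winding_map (fun x => x) (fun w => w) ?_ (fun _ _ => rfl) hw
  intro x i hx
  refine Or.inl ⟨i, rfl, ?_⟩
  have := h (proj 2 N x, i)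
  unfold liftOpen at *
  rw [hx] at this
  exact (top_le_iff (a := ω' (proj 2 N x, i))).mp this

/-- Events determined by existence of a winding vector with a given property. -/
def wev (N : ℕ) (Q : (Fin 2 → ℤ) → Prop) : Set (Config 2 N) :=
  {ω | ∃ w ∈ winding 2 N ω, Q w}

lemma wev_upper (Q : (Fin 2 → ℤ) → Prop) : IsUpperSet (wev N Q) := by
  rintro ω ω' h ⟨w, hw, hQ⟩
  exact ⟨w, winding_mono h hw, hQ⟩

lemma span_of_sub {ω ω' : Config 2 N} (h : winding 2 N ω ⊆ winding 2 N ω')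
    (hs : ω ∈ spanEvent 2 N) : ω' ∈ spanEvent 2 N := by
  change Submodule.span ℚ _ = ⊤ at hs
  change Submodule.span ℚ _ = ⊤
  rw [eq_top_iff, ← hs]
  exact Submodule.span_mono (Set.image_mono h)

lemma span_upper : IsUpperSet (spanEvent 2 N) := fun _ _ h hs => span_of_sub (winding_mono h) hs

/-- coordinate swap on edges -/
def swapE (N : ℕ) : Edge 2 N ≃ Edge 2 N where
  toFun e := (fun k => e.1 k.rev, e.2.rev)
  invFun e := (fun k => e.1 k.rev, e.2.rev)
  left_inv e := by ext <;> simp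
  right_inv e := by ext <;> simp

/-- reflection on edges -/
def reflE (N : ℕ) : Edge 2 N ≃ Edge 2 N where
  toFun e := (![-e.1 0 - (if e.2 = 0 then 1 else 0), e.1 1], e.2)
  invFun e := (![-e.1 0 - (if e.2 = 0 then 1 else 0), e.1 1], e.2)
  left_inv e := by
    refine Prod.ext ?_ rfl
    funext k
    fin_cases k <;> simp
  right_inv e := by
    refine Prod.ext ?_ rfl
    funext k
    fin_cases k <;> simp

/-- translation on edges -/
def transE (N : ℕ) (t : Fin 2 → ZMod N) : Edge 2 N ≃ Edge 2 N where
  toFun e := (e.1 + t, e.2)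
  invFun e := (e.1 - t, e.2)
  left_inv e := by simp
  right_inv e := by simp

lemma winding_swap {ω : Config 2 N} {w : Fin 2 → ℤ} (h : w ∈ winding 2 N ω) :
    (fun k => w k.rev) ∈ winding 2 N (fun e => ω (swapE N e)) := by
  refine winding_map (fun x k => x k.rev) (fun x k => x k.rev) ?_ ?_ h
  · intro x i hx
    refine Or.inl ⟨i.rev, ?_, ?_⟩
    · funext k
      fin_cases i <;> fin_cases k <;> simp [stdVec]
    · unfold liftOpen at *
      rw [← hx]
      refine congrArg ω ?_
      refine Prod.ext ?_ (Fin.rev_rev i)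
      funext k
      simp [swapE, proj]
  · intro x w; rfl

lemma winding_refl {ω : Config 2 N} {w : Fin 2 → ℤ} (h : w ∈ winding 2 N ω) :
    ![-w 0, w 1] ∈ winding 2 N (fun e => ω (reflE N e)) := by
  refine winding_map (fun x => ![-x 0, x 1]) (fun x => ![-x 0, x 1]) ?_ ?_ h
  · intro x i hx
    unfold liftOpen at hx
    fin_cases i
    · refine Or.inr ⟨0, ?_, ?_⟩
      · funext k
        fin_cases k <;> simp [stdVec]
      · unfold liftOpen
        rw [← hx]
        refine congrArg ω ?_
        refine Prod.ext ?_ rfl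
        funext k
        fin_cases k <;> simp [reflE, proj, stdVec]
    · refine Or.inl ⟨1, ?_, ?_⟩
      · funext k
        fin_cases k <;> simp [stdVec]
      · unfold liftOpen
        rw [← hx]
        refine congrArg ω ?_
        refine Prod.ext ?_ rfl
        funext k
        fin_cases k <;> simp [reflE, proj]
  · intro x w
    funext k
    fin_cases k <;> simp
    ring

lemma winding_trans [NeZero N] {ω : Config 2 N} (t : Fin 2 → ZMod N) :
    winding 2 N ω ⊆ winding 2 N (fun e => ω (transE N t e)) := by
  intro w h
  refine winding_map (fun x k => x k - ((t k).val : ℤ)) (fun x => x) ?_ ?_ h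
  · intro x i hx
    refine Or.inl ⟨i, ?_, ?_⟩
    · funext k
      simp only [Pi.add_apply]
      ring
    · unfold liftOpen at *
      rw [← hx]
      refine congrArg ω ?_
      refine Prod.ext ?_ rfl
      funext k
      simp [transE, proj]
  · intro x w
    funext k
    simp only [Pi.add_apply]
    ring

lemma Ex_ind_le_of_map [NeZero N] {p : ℝ} (h0 : 0 ≤ p) (h1 : p ≤ 1) (τ : Edge 2 N ≃ Edge 2 N)
    {S T : Set (Config 2 N)} (h : ∀ ω ∈ S, (fun e => ω (τ e)) ∈ T) :
    Ex p (ind S) ≤ Ex p (ind T) := by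
  rw [← Ex_equiv p τ (ind T)]
  exact Ex_mono h0 h1 fun x => ind_le (h x)

lemma Ex_ind_le [NeZero N] {p : ℝ} (h0 : 0 ≤ p) (h1 : p ≤ 1)
    {S T : Set (Config 2 N)} (h : S ⊆ T) : Ex p (ind S) ≤ Ex p (ind T) :=
  Ex_mono h0 h1 fun _ => ind_le fun hx => h hx

lemma Ex_ind_union [NeZero N] {p : ℝ} (h0 : 0 ≤ p) (h1 : p ≤ 1)
    (S T : Set (Config 2 N)) : Ex p (ind (S ∪ T)) ≤ Ex p (ind S) + Ex p (ind T) := by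
  rw [← Ex_add]
  refine Ex_mono h0 h1 fun x => ?_
  unfold ind
  by_cases hS : x ∈ S <;> by_cases hT : x ∈ T <;> simp [hS, hT]

lemma Ex_dual [NeZero N] (p : ℝ) (f : Config 2 N → ℝ) :
    Ex p (fun ω => f (dual ω)) = Ex (1 - p) f := by
  rw [← Ex_compl, ← Ex_equiv p (dualEdge N) (fun x => f (fun i => !x i))]
  rfl

lemma giant_half [NeZero N] : 1 / 2 ≤ Ex (1 / 2) (ind (giantEvent 2 N)) := by
  have h1 : (1 : ℝ) ≤ Ex (1 / 2) (fun ω => ind (giantEvent 2 N) ω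
      + ind (giantEvent 2 N) (dual ω)) := by
    refine (Ex_one (ι := Edge 2 N) (1 / 2)).symm.le.trans ?_
    refine Ex_mono (by norm_num) (by norm_num) fun ω => ?_
    have n1 := ind_nonneg (giantEvent 2 N) ω
    have n2 := ind_nonneg (giantEvent 2 N) (dual ω)
    rcases giant_or_dual ω with h | h
    · have : ind (giantEvent 2 N) ω = 1 := by simp [ind, h]
      linarith
    · have : ind (giantEvent 2 N) (dual ω) = 1 := by simp [ind, h]
      linarith
  rw [Ex_add, Ex_dual] at h1
  have e : (1 - 1 / 2 : ℝ) = 1 / 2 := by norm_num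
  rw [e] at h1
  linarith

lemma span_half [NeZero N] : 1 / 4096 ≤ Ex (1 / 2) (ind (spanEvent 2 N)) := by
  have z0 : (0 : ℝ) ≤ 1 / 2 := by norm_num
  have z1 : (1 / 2 : ℝ) ≤ 1 := by norm_num
  set H := wev N (fun w => w 0 ≠ 0)
  set V := wev N (fun w => w 1 ≠ 0)
  set D := wev N (fun w => 0 < w 0 * w 1)
  set D' := wev N (fun w => w 0 * w 1 < 0)
  set S := spanEvent 2 N
  have hA : Ex (1 / 2) (ind (giantEvent 2 N)) ≤ Ex (1 / 2) (ind (H ∪ V)) := by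
    refine Ex_ind_le z0 z1 fun ω hω => ?_
    obtain ⟨w, hw, hne⟩ := giant_iff.mp hω
    by_cases h0 : w 0 = 0
    · refine Or.inr ⟨w, hw, fun h1 => hne ?_⟩
      funext k
      fin_cases k
      · exact h0
      · exact h1
    · exact Or.inl ⟨w, hw, h0⟩
  have hHV : Ex (1 / 2) (ind H) ≤ Ex (1 / 2) (ind V) := by
    refine Ex_ind_le_of_map z0 z1 (swapE N) ?_
    rintro ω ⟨w, hw, h⟩
    exact ⟨_, winding_swap hw, by simpa using h⟩
  have hVH : Ex (1 / 2) (ind V) ≤ Ex (1 / 2) (ind H) := by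
    refine Ex_ind_le_of_map z0 z1 (swapE N) ?_
    rintro ω ⟨w, hw, h⟩
    exact ⟨_, winding_swap hw, by simpa using h⟩
  have hDD : Ex (1 / 2) (ind D) ≤ Ex (1 / 2) (ind D') := by
    refine Ex_ind_le_of_map z0 z1 (reflE N) ?_
    rintro ω ⟨w, hw, h⟩
    exact ⟨_, winding_refl hw, by simpa using h⟩
  have hDD' : Ex (1 / 2) (ind D') ≤ Ex (1 / 2) (ind D) := by
    refine Ex_ind_le_of_map z0 z1 (reflE N) ?_
    rintro ω ⟨w, hw, h⟩
    exact ⟨_, winding_refl hw, by simpa using h⟩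
  have a1 := giant_half (N := N)
  have a2 := Ex_ind_union z0 z1 H V
  have a3 := harris_half H V (wev_upper _) (wev_upper _)
  have a4 : Ex (1 / 2) (ind (H ∩ V)) ≤ Ex (1 / 2) (ind (S ∪ (D ∪ D'))) := by
    refine Ex_ind_le z0 z1 ?_
    rintro ω ⟨⟨w, hw, h0⟩, ⟨v, hv, h1⟩⟩
    by_cases e1 : w 1 = 0
    · by_cases e2 : v 0 = 0
      · refine Or.inl (span_of_det hw hv ?_)
        rw [e1, e2]
        simpa using ⟨h0, h1⟩
      · rcases lt_or_gt_of_ne (mul_ne_zero e2 h1) with h | h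
        · exact Or.inr (Or.inr ⟨v, hv, h⟩)
        · exact Or.inr (Or.inl ⟨v, hv, h⟩)
    · rcases lt_or_gt_of_ne (mul_ne_zero h0 e1) with h | h
      · exact Or.inr (Or.inr ⟨w, hw, h⟩)
      · exact Or.inr (Or.inl ⟨w, hw, h⟩)
  have a5 := Ex_ind_union z0 z1 S (D ∪ D')
  have a6 := Ex_ind_union z0 z1 D D'
  have a7 := harris_half D D' (wev_upper _) (wev_upper _)
  have a8 : Ex (1 / 2) (ind (D ∩ D')) ≤ Ex (1 / 2) (ind S) := by
    refine Ex_ind_le z0 z1 ?_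
    rintro ω ⟨⟨w, hw, h0⟩, ⟨v, hv, h1⟩⟩
    refine span_of_det hw hv fun h => ?_
    have e : w 0 * v 1 = w 1 * v 0 := by linarith
    have e2 : (w 0 * w 1) * (v 0 * v 1) = (w 1 * v 0) * (w 1 * v 0) := by
      rw [← e]; linear_combination (-(w 0 * v 1)) * h
    have := mul_neg_of_pos_of_neg h0 h1
    nlinarith [mul_self_nonneg (w 1 * v 0)]
  have hH : 1 / 4 ≤ Ex (1 / 2) (ind H) := by linarith
  have hV : 1 / 4 ≤ Ex (1 / 2) (ind V) := by linarith
  have hHV2 : 1 / 16 ≤ Ex (1 / 2) (ind H) * Ex (1 / 2) (ind V) := by nlinarith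
  by_cases hc : Ex (1 / 2) (ind D) ≤ 1 / 64
  · linarith
  · push Not at hc
    nlinarith

lemma span_sym [NeZero N] (t : ℝ) (h0 : 0 ≤ t) (h1 : t ≤ 1) (i : Edge 2 N) :
    (N : ℝ) ^ 2 * Ex t (piv (ind (spanEvent 2 N)) i)
      ≤ ∑ j, Ex t (piv (ind (spanEvent 2 N)) j) := by
  set f := ind (spanEvent 2 N)
  have hle : ∀ s x, f x ≤ f (fun e => x (transE N s e)) := fun s x =>
    ind_le (span_of_sub (winding_trans s))
  have hinv : ∀ s x, f (fun e => x (transE N s e)) = f x := by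
    intro s x
    refine le_antisymm ?_ (hle s x)
    refine (hle (-s) _).trans (le_of_eq ?_)
    congr 1
    funext e
    simp [transE]
  have hmono : Monotone f := fun x y h => ind_le (span_upper h)
  have hnn : ∀ j, 0 ≤ Ex t (piv f j) := fun j =>
    Ex_nonneg h0 h1 fun x => by
      simp only [piv, sub_nonneg]
      apply hmono
      intro k
      by_cases hk : k = j
      · subst hk; simp
      · simp [hk]
  obtain ⟨v, j⟩ := i
  have hc : ∀ v', Ex t (piv f (v', j)) = Ex t (piv f (v, j)) := by
    intro v'
    have := piv_equiv t (transE N (v' - v)) f (hinv _) (v, j)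
    simpa [transE] using this
  rw [Fintype.sum_prod_type_right]
  calc (N : ℝ) ^ 2 * Ex t (piv f (v, j)) = ∑ v', Ex t (piv f (v', j)) := by
        rw [Finset.sum_congr rfl fun v' _ => hc v']
        simp [ZMod.card]
    _ ≤ _ := Finset.single_le_sum (f := fun j => ∑ v', Ex t (piv f (v', j)))
        (fun k _ => Finset.sum_nonneg fun v' _ => hnn (v', k)) (Finset.mem_univ j)

lemma ind_le_one_Ex [NeZero N] {p : ℝ} (h0 : 0 ≤ p) (h1 : p ≤ 1) (S : Set (Config 2 N)) :
    Ex p (ind S) ≤ 1 := by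
  rw [← Ex_one (ι := Edge 2 N) p]
  refine Ex_mono h0 h1 fun x => ?_
  rcases ind_01 S x with h | h <;> rw [h] <;> norm_num

lemma span_large (p : ℝ) (hp : 1 / 2 < p) (hp1 : p ≤ 1) (ε : ℝ) (hε : 0 < ε) :
    ∃ N0 : ℕ, ∀ N ≥ N0, ∀ _ : NeZero N, 1 - ε < Ex p (ind (spanEvent 2 N)) := by
  obtain ⟨q, hq, hq1, hqp⟩ : ∃ q : ℝ, 1 / 2 < q ∧ q < 1 ∧ q ≤ p :=
    ⟨(1 / 2 + p) / 2, by linarith, by linarith, by linarith⟩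
  obtain ⟨N0, h⟩ := sharp q hq hq1 (1 / 4096) ε (by norm_num) hε
  refine ⟨N0, fun N hN _ => ?_⟩
  have hm : Monotone (ind (spanEvent 2 N)) := fun x y h => ind_le (span_upper h)
  refine (h N hN (Edge 2 N) (ind (spanEvent 2 N)) (ind_01 _) hm
    (fun t h0 h1 i => span_sym t h0 h1 i) span_half).trans_le ?_
  exact Ex_le_of_le (ind_01 _) hm (by linarith) hqp hp1

lemma tendsto_span (p : ℝ) (hp : 1 / 2 < p) (hp1 : p ≤ 1) :
    Filter.Tendsto (fun N : ℕ => prob 2 N p (spanEvent 2 N)) Filter.atTop (nhds 1) := by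
  rw [Metric.tendsto_atTop]
  intro ε hε
  obtain ⟨N0, h⟩ := span_large p hp hp1 ε hε
  refine ⟨N0 + 1, fun N hN => ?_⟩
  have : NeZero N := ⟨by omega⟩
  have h1 := h N (by omega) this
  have h2 := ind_le_one_Ex (by linarith) hp1 (spanEvent 2 N)
  rw [prob_eq, Real.dist_eq, abs_lt]
  constructor <;> linarith

lemma tendsto_giant (p : ℝ) (hp0 : 0 ≤ p) (hp : p < 1 / 2) :
    Filter.Tendsto (fun N : ℕ => prob 2 N p (giantEvent 2 N)) Filter.atTop (nhds 0) := by
  rw [Metric.tendsto_atTop]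
  intro ε hε
  obtain ⟨N0, h⟩ := span_large (1 - p) (by linarith) (by linarith) ε hε
  refine ⟨N0 + 1, fun N hN => ?_⟩
  have : NeZero N := ⟨by omega⟩
  have h1 := h N (by omega) this
  have h2 : 0 ≤ Ex p (ind (giantEvent 2 N)) := Ex_nonneg hp0 (by linarith) (ind_nonneg _)
  have h3 : Ex p (ind (giantEvent 2 N)) + Ex (1 - p) (ind (spanEvent 2 N)) ≤ 1 := by
    rw [← Ex_dual, ← Ex_add, ← Ex_one (ι := Edge 2 N) p]
    refine Ex_mono hp0 (by linarith) fun ω => ?_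
    by_cases hg : ω ∈ giantEvent 2 N
    · have := giant_dual_not_span hg
      simp [ind, hg, this]
    · have : ind (giantEvent 2 N) ω = 0 := by simp [ind, hg]
      rw [this]
      rcases ind_01 (spanEvent 2 N) (dual ω) with h | h <;> rw [h] <;> norm_num
  rw [prob_eq, Real.dist_eq, abs_lt]
  constructor <;> linarith

end Final

end HK
/-- Harris–Kesten on the torus: for bond percolation on the two-dimensional torus `T²_N`,
if `p < 1/2` then `ℙ_p(A^□) → 0` as `N → ∞`, and if `p > 1/2` then `ℙ_p(S^□) → 1`
as `N → ∞`. -/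
theorem torus2_harris_kesten (p : ℝ) :
    (0 ≤ p → p < 1 / 2 →
      Filter.Tendsto (fun N : ℕ => TorusPerc.prob 2 N p (TorusPerc.giantEvent 2 N))
        Filter.atTop (nhds 0)) ∧
    (1 / 2 < p → p ≤ 1 →
      Filter.Tendsto (fun N : ℕ => TorusPerc.prob 2 N p (TorusPerc.spanEvent 2 N))
        Filter.atTop (nhds 1)) := by
  
  exact ⟨fun h0 h => HK.tendsto_giant p h0 h, fun h h1 => HK.tendsto_span p h h1⟩
end

section
/- For every N ≥ 1, bond percolation on the two-dimensional torus T²_N at parameter p = 1/2 satisfies ℙ_{1/2}(A^□) ≥ 1/2. -/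
namespace TorusPerc

theorem proj_add (N : ℕ) (x y : Fin 2 → ℤ) : proj 2 N (x + y) = proj 2 N x + proj 2 N y := by
  funext i; simp [proj]

theorem proj_sub (N : ℕ) (x y : Fin 2 → ℤ) : proj 2 N (x - y) = proj 2 N x - proj 2 N y := by
  funext i; simp [proj]

theorem proj_surj (N : ℕ) (u : Fin 2 → ZMod N) : ∃ x, proj 2 N x = u := by
  choose f hf using fun i => ZMod.intCast_surjective (u i)
  exact ⟨f, funext hf⟩

theorem step_symm {N : ℕ} {ω : Config 2 N} {x y : Fin 2 → ℤ} (h : step 2 N ω x y) :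
    step 2 N ω y x := Or.symm h

theorem conn_symm {N : ℕ} {ω : Config 2 N} {x y : Fin 2 → ℤ} (h : connected 2 N ω x y) :
    connected 2 N ω y x := by
  unfold connected at *
  induction h with
  | refl => exact Relation.ReflTransGen.refl
  | tail _ hs ih => exact Relation.ReflTransGen.head (step_symm hs) ih

theorem conn_translate {N : ℕ} {ω : Config 2 N} {x y : Fin 2 → ℤ} (t : Fin 2 → ℤ)
    (ht : proj 2 N t = 0) (h : connected 2 N ω x y) : connected 2 N ω (x + t) (y + t) := by
  refine Relation.ReflTransGen.lift (fun z => z + t) ?_ _ _ h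
  rintro a b (⟨i, rfl, ho⟩ | ⟨i, rfl, ho⟩)
  · refine Or.inl ⟨i, add_right_comm _ _ _, ?_⟩
    simpa [liftOpen, proj_add, ht] using ho
  · refine Or.inr ⟨i, add_right_comm _ _ _, ?_⟩
    simpa [liftOpen, proj_add, ht] using ho

/-- Two torus vertices in the same open cluster. -/
def clusterSetoid (N : ℕ) (ω : Config 2 N) : Setoid (Fin 2 → ZMod N) where
  r u v := ∀ x, proj 2 N x = u → ∃ y, proj 2 N y = v ∧ connected 2 N ω x y
  iseqv := by
    refine ⟨fun u x hx => ⟨x, hx, Relation.ReflTransGen.refl⟩, ?_, ?_⟩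
    · intro u v h x hx
      obtain ⟨x', hx'⟩ := proj_surj N u
      obtain ⟨y', hy', hc⟩ := h x' hx'
      have ht : proj 2 N (x - y') = 0 := by rw [proj_sub, hx, hy', sub_self]
      refine ⟨x' + (x - y'), by rw [proj_add, ht, hx', add_zero], ?_⟩
      have := conn_symm (conn_translate _ ht hc)
      rwa [add_sub_cancel] at this
    · intro u v w h1 h2 x hx
      obtain ⟨y, hy, hc⟩ := h1 x hx
      obtain ⟨z, hz, hd⟩ := h2 y hy
      exact ⟨z, hz, Relation.ReflTransGen.trans hc hd⟩

theorem exists_lift (N : ℕ) (ω : Config 2 N) (h : ω ∉ giantEvent 2 N) :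
    ∃ L : (Fin 2 → ZMod N) → (Fin 2 → ℤ), ∀ u i, ω (u, i) = true →
      L (u + proj 2 N (stdVec 2 i)) = L u + stdVec 2 i := by
  have huniq : ∀ x y, proj 2 N x = proj 2 N y → connected 2 N ω x y → x = y := by
    intro x y hp hc
    by_contra hne
    exact h ⟨x, y, hne, hp, hc⟩
  let S := clusterSetoid N ω
  choose s hs using proj_surj N
  let r : (Fin 2 → ZMod N) → (Fin 2 → ZMod N) := fun u => (Quotient.mk S u).out
  have hr : ∀ u, ∃ y, proj 2 N y = u ∧ connected 2 N ω (s (r u)) y := by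
    intro u
    have : S.r (r u) u := Quotient.mk_out (s := S) u
    exact this _ (hs _)
  choose L hL hLc using hr
  refine ⟨L, fun u i ho => ?_⟩
  have hst : step 2 N ω (L u) (L u + stdVec 2 i) := Or.inl ⟨i, rfl, by
    simpa [liftOpen, hL] using ho⟩
  have hrel : S.r u (u + proj 2 N (stdVec 2 i)) := by
    intro x hx
    refine ⟨x + stdVec 2 i, by rw [proj_add, hx], Relation.ReflTransGen.single (Or.inl ⟨i, rfl, ?_⟩)⟩
    simpa [liftOpen, hx] using ho
  have hreq : r (u + proj 2 N (stdVec 2 i)) = r u := by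
    have : Quotient.mk S u = Quotient.mk S (u + proj 2 N (stdVec 2 i)) := Quotient.sound hrel
    simp only [r, this]
  have h1 := hLc (u + proj 2 N (stdVec 2 i))
  rw [hreq] at h1
  apply huniq
  · rw [hL, proj_add, hL]
  · exact (conn_symm h1).trans ((hLc u).trans (Relation.ReflTransGen.single hst))

/-- Unit vectors on the torus. -/
def tv (N : ℕ) (i : Fin 2) : Fin 2 → ZMod N := proj 2 N (stdVec 2 i)

/-- Crossing dual edge: the edge in direction `i` at `v` is crossed by the dual edge in the
other direction. -/
def dualEdge (N : ℕ) : Edge 2 N ≃ Edge 2 N where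
  toFun e := (e.1 - tv N (1 - e.2), 1 - e.2)
  invFun e := (e.1 + tv N e.2, 1 - e.2)
  left_inv e := by ext <;> simp
  right_inv e := by ext <;> simp

/-- The dual configuration. -/
def dualConf (N : ℕ) : Config 2 N ≃ Config 2 N where
  toFun ω e := !ω ((dualEdge N).symm e)
  invFun ω e := !ω (dualEdge N e)
  left_inv ω := by funext e; simp
  right_inv ω := by funext e; simp

theorem sum_zero {V : Type*} [AddCommGroup V] [Fintype V] (a b : V) (h k : V → ℤ) :
    ∑ v, ((1 - (h (v + a) - h v)) * (1 - (k v - k (v - b)))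
      - (h (v + b) - h v) * (k v - k (v - a))) = Fintype.card V := by
  have sh : ∀ (f : V → ℤ) (t : V), ∑ v, f (v + t) = ∑ v, f v := fun f t =>
    Equiv.sum_comp (Equiv.addRight t) f
  have e1 := sh h a
  have e2 := sh (fun v => k (v - b)) b
  have e3 := sh (fun v => h (v + a) * k (v - b)) b
  have e4 := sh (fun v => h (v + b) * k (v - a)) a
  have e5 := sh (fun v => h v * k (v - b)) b
  have e6 := sh (fun v => h v * k (v - a)) a
  simp only [add_sub_cancel_right] at e2 e3 e4 e5 e6
  have e7 : ∀ v, v + b + a = v + a + b := fun v => by abel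
  simp only [e7] at e3
  have : ∀ v, ((1 - (h (v + a) - h v)) * (1 - (k v - k (v - b)))
      - (h (v + b) - h v) * (k v - k (v - a))) =
      1 - h (v + a) + h v - k v + k (v - b) + h (v + a) * k v - h (v + a) * k (v - b)
      + h v * k (v - b) - h (v + b) * k v + h (v + b) * k (v - a) - h v * k (v - a) := by
    intro v; ring
  simp only [this, Finset.sum_sub_distrib, Finset.sum_add_distrib]
  simp only [Finset.sum_const, Finset.card_univ, nsmul_eq_mul, mul_one]
  linarith

theorem giant_or_dual (N : ℕ) (hN : 1 ≤ N) (ω : Config 2 N) :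
    ω ∈ giantEvent 2 N ∨ dualConf N ω ∈ giantEvent 2 N := by
  by_contra! hcon
  haveI : NeZero N := ⟨by omega⟩
  obtain ⟨L, hL⟩ := exists_lift N ω hcon.1
  obtain ⟨K, hK⟩ := exists_lift N _ hcon.2
  have key := sum_zero (tv N 0) (tv N 1) (fun v => L v 0) (fun v => K v 1)
  have hz : ∀ v : Fin 2 → ZMod N, ((1 - (L (v + tv N 0) 0 - L v 0)) * (1 - (K v 1 - K (v - tv N 1) 1))
      - (L (v + tv N 1) 0 - L v 0) * (K v 1 - K (v - tv N 0) 1)) = 0 := by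
    intro v
    have p1 : (1 - (L (v + tv N 0) 0 - L v 0)) * (1 - (K v 1 - K (v - tv N 1) 1)) = 0 := by
      cases ho : ω (v, 0) with
      | true => 
        have := congrFun (hL v 0 ho) 0
        simp [stdVec] at this
        simp [tv, stdVec, this]
      | false =>
        have := congrFun (hK (v - tv N 1) 1 (by simp [dualConf, dualEdge, ho])) 1
        change K (v - tv N 1 + tv N 1) 1 = _ at this
        simp [stdVec] at this
        simp [this]
    have p2 : (L (v + tv N 1) 0 - L v 0) * (K v 1 - K (v - tv N 0) 1) = 0 := by
      cases ho : ω (v, 1) with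
      | true => 
        have := congrFun (hL v 1 ho) 0
        change L (v + tv N 1) 0 = _ at this
        simp [stdVec] at this
        simp [this]
      | false =>
        have := congrFun (hK (v - tv N 0) 0 (by simp [dualConf, dualEdge, ho])) 1
        change K (v - tv N 0 + tv N 0) 1 = _ at this
        simp [stdVec] at this
        simp [this]
    rw [p1, p2, sub_zero]
  simp only [hz, Finset.sum_const_zero] at key
  have : Fintype.card (Fin 2 → ZMod N) ≠ 0 := Fintype.card_ne_zero
  exact this (by exact_mod_cast key.symm)

end TorusPerc

open TorusPerc in
theorem prob_half_aux (N : ℕ) (hN : 1 ≤ N) :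
    1 / 2 ≤ TorusPerc.prob 2 N (1 / 2) (TorusPerc.giantEvent 2 N) := by
  classical
  haveI : NeZero N := ⟨by omega⟩
  have hc : ∀ ω : Config 2 N, ∏ᶠ e : Edge 2 N, (if ω e then (1/2:ℝ) else 1 - 1/2)
      = (1/2) ^ Fintype.card (Edge 2 N) := by
    intro ω
    rw [finprod_eq_prod_of_fintype]
    have : ∀ e, (if ω e then (1/2:ℝ) else 1 - 1/2) = 1/2 := by intro e; split_ifs <;> norm_num
    simp only [this, Finset.prod_const, Finset.card_univ]
  unfold prob
  simp only [hc]
  rw [finsum_mem_eq_finite_toFinset_sum _ (Set.toFinite _), Finset.sum_const, nsmul_eq_mul]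
  set A := (Set.toFinite (giantEvent 2 N)).toFinset with hA
  have hcov : (Finset.univ : Finset (Config 2 N)) ⊆ A ∪ A.map (dualConf N).symm.toEmbedding := by
    intro ω _
    rw [Finset.mem_union, Finset.mem_map_equiv]
    simpa [hA] using giant_or_dual N hN ω
  have hcard := (Finset.card_le_card hcov).trans (Finset.card_union_le _ _)
  rw [Finset.card_map, Finset.card_univ, Fintype.card_fun, Fintype.card_bool] at hcard
  have hcard' : (2:ℝ) ^ Fintype.card (Edge 2 N) ≤ A.card + A.card := by exact_mod_cast hcard
  rw [one_div_pow, mul_one_div, div_le_div_iff₀ (by norm_num) (by positivity)]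
  linarith

/-- For every `N ≥ 1`, bond percolation on the two-dimensional torus `T²_N` at
parameter `p = 1/2` satisfies `ℙ_{1/2}(A^□) ≥ 1/2`. -/
theorem torus_half_giant_prob_ge_half (N : ℕ) (hN : 1 ≤ N) :
    1 / 2 ≤ TorusPerc.prob 2 N (1 / 2) (TorusPerc.giantEvent 2 N) := by
  exact prob_half_aux N hN
end
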